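/- Let n ≥ 3, let λ ∈ ℝⁿ be strictly decreasing (λ₁ > ⋯ > λₙ), and let N be an n×n skew-Hermitian complex matrix. Then the following are equivalent: (a) N is a scalar multiple of the identity matrix; (b) for every differentiable function L : ℝ → (n×n complex matrices) satisfying L′(t) = [L(t), [L(t), N]] for all t ∈ ℝ and L(0) ∈ O_λ^{≥0}, one has L(t) ∈ O_λ^{≥0} for all t ≥ 0. In other words, the double-bracket (normal-metric gradient) flow with respect to N weakly preserves the totally nonnegative part of the orbit if and only if the flow is constant. -/

import Mathlib

open Matrix Finset

/-- The minor of a square matrix `g` on row set `I` and column set `J`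
(rows and columns listed in increasing order); defined to be `0` if `I` and `J`
have different cardinalities. -/
noncomputable def minorOn {R : Type} [CommRing R] {n : ℕ} (g : Matrix (Fin n) (Fin n) R)
    (I J : Finset (Fin n)) : R :=
  if h : J.card = I.card then
    Matrix.det (Matrix.of fun a b : Fin I.card =>
      g ((I.orderIsoOfFin rfl a : Fin n)) ((J.orderIsoOfFin h b : Fin n)))
  else 0

/-- The left-justified minor `Δ_I(g)`: the minor on rows `I` and the first `|I|` columns. -/
noncomputable def leftMinor {R : Type} [CommRing R] {n : ℕ} (g : Matrix (Fin n) (Fin n) R)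
    (I : Finset (Fin n)) : R :=
  minorOn g I (Finset.univ.filter fun j : Fin n => (j : ℕ) < I.card)

/-- A complex number is a positive real. -/
def IsPosReal (z : ℂ) : Prop := 0 < z.re ∧ z.im = 0

/-- A complex number is a nonnegative real. -/
def IsNonnegReal (z : ℂ) : Prop := 0 ≤ z.re ∧ z.im = 0

/-- The diagonal sign matrix `δ_n = diag(1, −1, 1, …, (−1)^{n−1})`. -/
noncomputable def deltaMat (n : ℕ) : Matrix (Fin n) (Fin n) ℂ :=
  Matrix.diagonal fun i : Fin n => (-1 : ℂ) ^ (i : ℕ)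

/-- The totally positive part `U_n^{>0}` of the unitary group: unitary matrices all of
whose left-justified minors are positive real numbers. -/
def UnitaryTP (n : ℕ) : Set (Matrix (Fin n) (Fin n) ℂ) :=
  {g | g.conjTranspose * g = 1 ∧ ∀ I : Finset (Fin n), IsPosReal (leftMinor g I)}

/-- The totally positive part `O_λ^{>0}` of the adjoint orbit of `u_n`: skew-Hermitian
matrices `g · (i·diag(λ)) · g*` with `g ∈ U_n^{>0}`. -/
def SkewOrbitTP {n : ℕ} (lam : Fin n → ℝ) : Set (Matrix (Fin n) (Fin n) ℂ) :=
  {L | ∃ g ∈ UnitaryTP n,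
    L = g * (Complex.I • Matrix.diagonal (fun i => (lam i : ℂ))) * g.conjTranspose}

/-- The totally nonnegative part `O_λ^{≥0}`: the closure of `O_λ^{>0}` in the space of
`n×n` complex matrices. -/
noncomputable def SkewOrbitTNN {n : ℕ} (lam : Fin n → ℝ) : Set (Matrix (Fin n) (Fin n) ℂ) :=
  closure (SkewOrbitTP lam)

section ODEPart

theorem global_ode {E : Type*} [NormedAddCommGroup E] [NormedSpace ℝ E] [CompleteSpace E]
    (v : E → E) (K : NNReal) (hv : LipschitzWith K v) (C : NNReal) (hC : ∀ x, ‖v x‖ ≤ C) (x : E) :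
    ∃ γ : ℝ → E, γ 0 = x ∧ ∀ t, HasDerivAt γ (v (γ t)) t := by
  have hloc : ∀ T : ℝ, ∃ γ : ℝ → E, 0 < T → (γ 0 = x ∧ ∀ t ∈ Set.Ioo (-T) T,
      HasDerivAt γ (v (γ t)) t) := by
    intro T
    by_cases hT : 0 < T
    swap
    · exact ⟨fun _ => x, fun h => absurd h hT⟩
    have hmem : (0 : ℝ) ∈ Set.Icc (-T) T := ⟨by linarith, hT.le⟩
    have hP : IsPicardLindelof (fun _ => v) (tmin := -T) (tmax := T) ⟨0, hmem⟩ x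
        (C * T.toNNReal) 0 C K :=
      { lipschitzOnWith := fun t _ => hv.lipschitzOnWith
        continuousOn := fun x _ => continuousOn_const
        norm_le := fun t _ x _ => hC x
        mul_max_le := by simp [hT.le] }
    obtain ⟨γ, h0, h1⟩ := hP.exists_eq_forall_mem_Icc_hasDerivWithinAt₀
    refine ⟨γ, fun _ => ⟨h0, fun t ht => ?_⟩⟩
    exact (h1 t (Set.Ioo_subset_Icc_self ht)).hasDerivAt (Icc_mem_nhds ht.1 ht.2)
  choose γ hγ using hloc
  have huniq : ∀ S T : ℝ, 0 < S → S ≤ T → Set.EqOn (γ S) (γ T) (Set.Ioo (-S) S) := by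
    intro S T hS hST
    have h1 := hγ S hS
    have h2 := hγ T (lt_of_lt_of_le hS hST)
    refine ODE_solution_unique_of_mem_Ioo (v := fun _ => v) (s := fun _ => Set.univ) (K := K)
      (t₀ := 0) (fun t _ => hv.lipschitzOnWith) ⟨by linarith, hS⟩
      (fun t ht => ⟨h1.2 t ht, trivial⟩)
      (fun t ht => ⟨h2.2 t ⟨by linarith [ht.1], by linarith [ht.2]⟩, trivial⟩)
      (by rw [h1.1, h2.1])
  refine ⟨fun t => γ (|t| + 1) t, (hγ (|0| + 1) (by positivity)).1, fun t => ?_⟩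
  have hT : (0 : ℝ) < |t| + 2 := by positivity
  have hd := (hγ (|t| + 2) hT).2 t ⟨by linarith [neg_abs_le t], by linarith [le_abs_self t]⟩
  have hev : (fun s => γ (|s| + 1) s) =ᶠ[nhds t] γ (|t| + 2) := by
    have : Set.Ioo (-(|t| + 1)) (|t| + 1) ∈ nhds t :=
      Ioo_mem_nhds (by linarith [neg_abs_le t]) (by linarith [le_abs_self t])
    filter_upwards [this] with s hs
    have : |s| < |t| + 1 := abs_lt.mpr hs
    exact huniq (|s| + 1) (|t| + 2) (by positivity) (by linarith)
      ⟨by linarith [neg_abs_le s], by linarith [le_abs_self s]⟩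
  have heq : γ (|t| + 1) t = γ (|t| + 2) t := hev.eq_of_nhds
  simp only [heq]
  exact hd.congr_of_eventuallyEq hev

/-- Entrywise derivative. -/
def EHD {n : ℕ} (X : ℝ → Matrix (Fin n) (Fin n) ℂ) (X' : Matrix (Fin n) (Fin n) ℂ) (t : ℝ) : Prop :=
  ∀ i j, HasDerivAt (fun s => X s i j) (X' i j) t

theorem EHD.mul {n : ℕ} {X Y : ℝ → Matrix (Fin n) (Fin n) ℂ} {X' Y' : Matrix (Fin n) (Fin n) ℂ}
    {t : ℝ} (hX : EHD X X' t) (hY : EHD Y Y' t) :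
    EHD (fun s => X s * Y s) (X' * Y t + X t * Y') t := by
  intro i j
  simp only [Matrix.mul_apply, Matrix.add_apply, ← Finset.sum_add_distrib]
  exact HasDerivAt.fun_sum fun k _ => (hX i k).mul (hY k j)

theorem EHD.add {n : ℕ} {X Y : ℝ → Matrix (Fin n) (Fin n) ℂ} {X' Y' : Matrix (Fin n) (Fin n) ℂ}
    {t : ℝ} (hX : EHD X X' t) (hY : EHD Y Y' t) :
    EHD (fun s => X s + Y s) (X' + Y') t := fun i j => (hX i j).add (hY i j)

theorem EHD.const {n : ℕ} (X : Matrix (Fin n) (Fin n) ℂ) (t : ℝ) :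
    EHD (fun _ => X) 0 t := fun i j => hasDerivAt_const t (X i j)

theorem EHD.conjTranspose {n : ℕ} {X : ℝ → Matrix (Fin n) (Fin n) ℂ}
    {X' : Matrix (Fin n) (Fin n) ℂ} {t : ℝ} (hX : EHD X X' t) :
    EHD (fun s => (X s).conjTranspose) X'.conjTranspose t := by
  intro i j
  simpa using (hX j i).star

theorem EHD.const_of_zero {n : ℕ} {X : ℝ → Matrix (Fin n) (Fin n) ℂ}
    (hX : ∀ t, EHD X 0 t) (t : ℝ) : X t = X 0 := by
  ext i j
  exact is_const_of_deriv_eq_zero (f := fun s => X s i j) (fun s => (hX s i j).differentiableAt)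
    (fun s => (hX s i j).deriv) t 0

/-- The double bracket vector field. -/
def dbl {n : ℕ} (N L : Matrix (Fin n) (Fin n) ℂ) : Matrix (Fin n) (Fin n) ℂ :=
  L * (L * N - N * L) - (L * N - N * L) * L

attribute [local instance] Matrix.normedAddCommGroup Matrix.normedSpace

theorem dbl_contDiff {n : ℕ} (N : Matrix (Fin n) (Fin n) ℂ) :
    ContDiff ℝ 1 (fun L : Matrix (Fin n) (Fin n) ℂ => dbl N ((1 / 2 : ℂ) • (L - L.conjTranspose))) := by
  have happ : ∀ i j : Fin n, ContDiff ℝ 1 (fun L : Matrix (Fin n) (Fin n) ℂ => L i j) := by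
    intro i j
    exact contDiff_apply_apply ℝ ℂ i j
  have hconj : ∀ i j : Fin n, ContDiff ℝ 1 (fun L : Matrix (Fin n) (Fin n) ℂ => star (L i j)) := by
    intro i j
    exact Complex.conjCLE.contDiff.comp (happ i j)
  refine contDiff_pi.2 fun i => contDiff_pi.2 fun j => ?_
  simp only [dbl, Matrix.sub_apply, Matrix.mul_apply, Matrix.smul_apply, Matrix.conjTranspose_apply,
    smul_eq_mul]
  fun_prop

theorem flow_exists {n : ℕ} (N : Matrix (Fin n) (Fin n) ℂ) (hN : N.conjTranspose = -N)
    (L0 : Matrix (Fin n) (Fin n) ℂ) (hL0 : L0.conjTranspose = -L0) :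
    ∃ L : ℝ → Matrix (Fin n) (Fin n) ℂ, L 0 = L0 ∧ ∀ t, EHD L (dbl N (L t)) t := by
  set F : Matrix (Fin n) (Fin n) ℂ → ℝ := fun L => ∑ i, ∑ j, ‖L i j‖ ^ 2 with hF
  set R : ℝ := F L0 + 1 with hR
  have hF0 : 0 ≤ F L0 := by positivity
  let φ : ContDiffBump (0 : Matrix (Fin n) (Fin n) ℂ) := ⟨R, R + 1, by positivity, by linarith⟩
  set v : Matrix (Fin n) (Fin n) ℂ → Matrix (Fin n) (Fin n) ℂ :=
    fun L => φ L • dbl N ((1 / 2 : ℂ) • (L - L.conjTranspose)) with hv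
  have hvs : ContDiff ℝ 1 v := φ.contDiff.smul (dbl_contDiff N)
  have hvc : HasCompactSupport v := φ.hasCompactSupport.smul_right
  obtain ⟨K, hK⟩ := ContDiff.lipschitzWith_of_hasCompactSupport hvc hvs (by simp)
  obtain ⟨C, hC⟩ := hvc.exists_bound_of_continuous hvs.continuous
  obtain ⟨L, h0, hL⟩ := global_ode v K hK C.toNNReal
    (fun x => (hC x).trans (Real.le_coe_toNNReal C)) L0
  have hL' : ∀ t, EHD L (v (L t)) t := fun t i j =>
    (hasDerivAt_pi.1 (hasDerivAt_pi.1 (hL t) i) j)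
  -- `v` is skew
  have hdskew : ∀ S : Matrix (Fin n) (Fin n) ℂ, S.conjTranspose = -S →
      (dbl N S).conjTranspose = - dbl N S := by
    intro S hS
    simp only [dbl, Matrix.conjTranspose_sub, Matrix.conjTranspose_mul, hS, hN]
    noncomm_ring
  have hvskew : ∀ X, (v X).conjTranspose = - v X := by
    intro X
    simp only [hv, Matrix.conjTranspose_smul]
    rw [hdskew]
    · simp
    · rw [Matrix.conjTranspose_smul]
      simp [smul_sub]
  have hskew : ∀ t, (L t).conjTranspose = - L t := by
    intro t
    have := EHD.const_of_zero (X := fun s => L s + (L s).conjTranspose) (fun s => by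
      have := (hL' s).add (hL' s).conjTranspose
      rw [hvskew, add_neg_cancel] at this
      exact this) t
    simp only [h0, hL0, add_neg_cancel] at this
    exact (neg_eq_of_add_eq_zero_right this).symm
  have hvL : ∀ t, v (L t) = φ (L t) • dbl N (L t) := by
    intro t
    simp only [hv, hskew t]
    congr 2
    rw [sub_neg_eq_add, ← two_smul ℂ (L t), smul_smul]
    norm_num
  -- Frobenius norm
  have hFtr : ∀ X : Matrix (Fin n) (Fin n) ℂ, ((F X : ℝ) : ℂ) = (X.conjTranspose * X).trace := by
    intro X
    simp only [hF, Matrix.trace, Matrix.diag, Matrix.mul_apply, Matrix.conjTranspose_apply]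
    rw [Finset.sum_comm]
    push_cast
    refine Finset.sum_congr rfl fun i _ => Finset.sum_congr rfl fun j _ => ?_
    rw [← Complex.conj_mul']; rfl
  have hFc : ∀ t, F (L t) = F L0 := by
    intro t
    have hd : ∀ s, HasDerivAt (fun s => ((L s).conjTranspose * L s).trace) 0 s := by
      intro s
      have h1 := (hL' s).conjTranspose.mul (hL' s)
      have h2 : HasDerivAt (fun s => ((L s).conjTranspose * L s).trace)
          (((v (L s)).conjTranspose * L s + (L s).conjTranspose * v (L s)).trace) s := by
        simp only [Matrix.trace, Matrix.diag]
        exact HasDerivAt.fun_sum fun k _ => h1 k k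
      have h3 : (((v (L s)).conjTranspose * L s + (L s).conjTranspose * v (L s)).trace) = 0 := by
        have h4 : (dbl N (L s) * L s).trace = 0 := by
          simp only [dbl, Matrix.sub_mul, Matrix.mul_sub, Matrix.trace_sub]
          rw [Matrix.trace_mul_comm (L s * (L s * N)), Matrix.trace_mul_comm (L s * (N * L s))]
          simp only [Matrix.mul_assoc]
          have e1 : (L s * (N * (L s * L s))).trace = (N * (L s * (L s * L s))).trace := by
            rw [Matrix.trace_mul_comm]; simp only [Matrix.mul_assoc]
          have e2 : (L s * (L s * (L s * N))).trace = (N * (L s * (L s * L s))).trace := by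
            rw [← Matrix.mul_assoc, ← Matrix.mul_assoc, Matrix.trace_mul_comm]
            simp only [Matrix.mul_assoc]
          have e3 : (L s * (L s * (N * L s))).trace = (N * (L s * (L s * L s))).trace := by
            rw [← Matrix.mul_assoc, Matrix.trace_mul_comm]
            simp only [Matrix.mul_assoc]
          rw [e1, e2, e3]; ring
        rw [hvskew, hskew, hvL, Matrix.trace_add, neg_mul, neg_mul, Matrix.trace_neg,
          Matrix.trace_neg, Matrix.trace_mul_comm (L s), smul_mul_assoc, Matrix.trace_smul, h4]
        simp
      rw [h3] at h2
      exact h2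
    have := is_const_of_deriv_eq_zero (fun s => (hd s).differentiableAt) (fun s => (hd s).deriv) t 0
    rw [← hFtr, ← hFtr, h0] at this
    exact_mod_cast this
  have hφ : ∀ t, φ (L t) = 1 := by
    intro t
    apply φ.one_of_mem_closedBall
    rw [mem_closedBall_zero_iff]
    change ‖L t‖ ≤ R
    rw [Matrix.norm_le_iff (by positivity)]
    intro i j
    have h1 : ‖L t i j‖ ^ 2 ≤ F (L t) := by
      have a1 : ‖L t i j‖ ^ 2 ≤ ∑ j, ‖L t i j‖ ^ 2 :=
        Finset.single_le_sum (f := fun j => ‖L t i j‖ ^ 2) (fun _ _ => by positivity) (Finset.mem_univ j)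
      have a2 : ∑ j, ‖L t i j‖ ^ 2 ≤ F (L t) :=
        Finset.single_le_sum (f := fun i => ∑ j, ‖L t i j‖ ^ 2) (fun _ _ => by positivity)
          (Finset.mem_univ i)
      exact a1.trans a2
    rw [hFc] at h1
    nlinarith [norm_nonneg (L t i j)]
  refine ⟨L, h0, fun t => ?_⟩
  have := hL' t
  rw [hvL, hφ, one_smul] at this
  exact this

end ODEPart

section MinorPart

/-- Left-justified minor with rows given by a map `f`. -/
def DM {R : Type} [CommRing R] {n k : ℕ} (hk : k ≤ n) (M : Matrix (Fin n) (Fin n) R)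
    (f : Fin k → Fin n) : R :=
  Matrix.det (Matrix.of fun a b : Fin k => M (f a) (Fin.castLE hk b))

theorem leftMinor_eq_DM {R : Type} [CommRing R] {n : ℕ} (M : Matrix (Fin n) (Fin n) R)
    (I : Finset (Fin n)) (hI : I.card ≤ n) :
    leftMinor M I = DM hI M (I.orderEmbOfFin rfl) := by
  have hc : (Finset.univ.filter fun j : Fin n => (j : ℕ) < I.card).card = I.card := by
    rw [Fin.card_filter_val_lt]; exact min_eq_right hI
  unfold leftMinor minorOn DM
  rw [dif_pos hc]
  congr 1
  ext a b
  simp only [Matrix.of_apply, Finset.coe_orderIsoOfFin_apply]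
  congr 1
  have : (Fin.castLE hI : Fin I.card → Fin n) =
      (Finset.univ.filter fun j : Fin n => (j : ℕ) < I.card).orderEmbOfFin hc :=
    Finset.orderEmbOfFin_unique hc (fun x => by simp) (Fin.strictMono_castLE hI)
  rw [this]

theorem DM_eq_leftMinor {R : Type} [CommRing R] {n k : ℕ} (hk : k ≤ n)
    (M : Matrix (Fin n) (Fin n) R) (f : Fin k → Fin n) (hf : StrictMono f) :
    DM hk M f = leftMinor M (Finset.univ.image f) := by
  have key : ∀ I : Finset (Fin n), I = Finset.univ.image f → ∀ h : I.card = k,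
      DM hk M f = leftMinor M I := by
    intro I hI h
    subst h
    rw [leftMinor_eq_DM M I hk]
    congr 1
    exact Finset.orderEmbOfFin_unique rfl (fun x => by rw [hI]; simp) hf
  exact key _ rfl (by rw [Finset.card_image_of_injective _ hf.injective]; simp)

theorem DM_row_op {n k : ℕ} (hk : k ≤ n) (M : Matrix (Fin n) (Fin n) ℝ) (f : Fin k → Fin n)
    (hf : Function.Injective f) (a b : Fin n) (t : ℝ) (x : Fin k) (hx : f x = a) :
    DM hk (Matrix.transvection a b t * M) f = DM hk M f + t * DM hk M (Function.update f x b) := by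
  have h1 : (Matrix.of fun p q : Fin k => (Matrix.transvection a b t * M) (f p) (Fin.castLE hk q)) =
      Matrix.updateRow (Matrix.of fun p q : Fin k => M (f p) (Fin.castLE hk q)) x
        ((fun q => M (f x) (Fin.castLE hk q)) + t • (fun q => M b (Fin.castLE hk q))) := by
    ext p q
    by_cases hp : p = x
    · subst hp
      subst hx
      simp [Matrix.transvection_mul_apply_same]
    · have : f p ≠ a := fun h => hp (hf (h.trans hx.symm))
      simp [Matrix.updateRow_ne hp, Matrix.transvection_mul_apply_of_ne _ _ _ _ this]
  have h2 : Matrix.updateRow (Matrix.of fun p q : Fin k => M (f p) (Fin.castLE hk q)) x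
        (fun q => M (f x) (Fin.castLE hk q)) =
        (Matrix.of fun p q : Fin k => M (f p) (Fin.castLE hk q)) := by
    ext p q
    by_cases hp : p = x
    · subst hp; simp
    · simp [Matrix.updateRow_ne hp]
  have h3 : Matrix.updateRow (Matrix.of fun p q : Fin k => M (f p) (Fin.castLE hk q)) x
        (fun q => M b (Fin.castLE hk q)) =
        (Matrix.of fun p q : Fin k => M (Function.update f x b p) (Fin.castLE hk q)) := by
    ext p q
    by_cases hp : p = x
    · subst hp; simp
    · simp [Matrix.updateRow_ne hp, Function.update_of_ne hp]
  unfold DM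
  rw [h1, Matrix.det_updateRow_add, Matrix.det_updateRow_smul, h2, h3]

theorem DM_row_op_not_mem {n k : ℕ} (hk : k ≤ n) (M : Matrix (Fin n) (Fin n) ℝ) (f : Fin k → Fin n)
    (a b : Fin n) (t : ℝ) (hx : ∀ x, f x ≠ a) :
    DM hk (Matrix.transvection a b t * M) f = DM hk M f := by
  unfold DM
  congr 1
  ext p q
  simp [Matrix.transvection_mul_apply_of_ne _ _ _ _ (hx p)]

theorem DM_not_inj {n k : ℕ} (hk : k ≤ n) (M : Matrix (Fin n) (Fin n) ℝ) (f : Fin k → Fin n)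
    (x y : Fin k) (hxy : x ≠ y) (h : f x = f y) : DM hk M f = 0 := by
  unfold DM
  exact Matrix.det_zero_of_row_eq hxy (by ext q; simp [h])

/-- adjacency in `Fin n` -/
def Adj {n : ℕ} (a b : Fin n) : Prop := (a : ℕ) + 1 = b ∨ (b : ℕ) + 1 = a

theorem Adj.symm {n : ℕ} {a b : Fin n} (h : Adj a b) : Adj b a := Or.symm h

theorem update_strictMono {n k : ℕ} (f : Fin k → Fin n) (hf : StrictMono f) (x : Fin k)
    (b : Fin n) (hab : Adj (f x) b) (hb : ∀ y, f y ≠ b) : StrictMono (Function.update f x b) := by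
  intro p q hpq
  have hpq' := hf hpq
  by_cases hp : p = x
  · subst hp
    have hq : q ≠ p := hpq.ne'
    rw [Function.update_self, Function.update_of_ne hq]
    have := hb q
    simp only [Fin.lt_def, ne_eq, Fin.ext_iff] at *
    rcases hab with h | h <;> omega
  · rw [Function.update_of_ne hp]
    by_cases hq : q = x
    · subst hq
      rw [Function.update_self]
      have := hb p
      simp only [Fin.lt_def, ne_eq, Fin.ext_iff] at *
      rcases hab with h | h <;> omega
    · rw [Function.update_of_ne hq]; exact (hf hpq)

/-- For strictly increasing `f`, an adjacent row operation adds a nonnegative multiple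
of a minor of the same size (or nothing). -/
theorem DM_adj_cases {n k : ℕ} (hk : k ≤ n) (M : Matrix (Fin n) (Fin n) ℝ) (f : Fin k → Fin n)
    (hf : StrictMono f) (a b : Fin n) (hab : Adj a b) (t : ℝ) :
    DM hk (Matrix.transvection a b t * M) f = DM hk M f ∨
    ∃ f' : Fin k → Fin n, StrictMono f' ∧
      DM hk (Matrix.transvection a b t * M) f = DM hk M f + t * DM hk M f' := by
  by_cases h : ∃ x, f x = a
  · obtain ⟨x, hx⟩ := h
    have h1 := DM_row_op hk M f hf.injective a b t x hx
    by_cases hb : ∃ y, f y = b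
    · obtain ⟨y, hy⟩ := hb
      left
      rw [h1, DM_not_inj hk M (Function.update f x b) x y]
      · ring
      · rintro rfl
        have : a = b := hx.symm.trans hy
        subst this
        rcases hab with h | h <;> omega
      · have : y ≠ x := by
          rintro rfl
          have : a = b := hx.symm.trans hy
          subst this
          rcases hab with h | h <;> omega
        rw [Function.update_self, Function.update_of_ne this, hy]
    · push Not at hb
      right
      exact ⟨_, update_strictMono f hf x b (hx ▸ hab) hb, h1⟩
  · push Not at h
    left
    exact DM_row_op_not_mem hk M f a b t h

/-- connectivity of strictly increasing maps under adjacent moves -/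
theorem strictMono_connect {n k : ℕ} (hk : k ≤ n) (Q : (Fin k → Fin n) → Prop)
    (hQ : ∀ f, StrictMono f → ∀ x b, Adj (f x) b → (∀ y, f y ≠ b) →
      (Q f ↔ Q (Function.update f x b))) (f : Fin k → Fin n) (hf : StrictMono f) :
    Q f ↔ Q (Fin.castLE hk) := by
  induction hs : ∑ x, (f x : ℕ) using Nat.strong_induction_on generalizing f with
  | _ s ih =>
    by_cases hfe : f = Fin.castLE hk
    · rw [hfe]
    · have : ∃ x : Fin k, (f x : ℕ) ≠ x := by
        by_contra hcon
        push Not at hcon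
        exact hfe (funext fun x => Fin.ext (by simp [hcon x]))
      obtain ⟨x, hx, hmin⟩ : ∃ x : Fin k, (f x : ℕ) ≠ x ∧ ∀ y < x, (f y : ℕ) = y := by
        let S := Finset.univ.filter fun x : Fin k => (f x : ℕ) ≠ x
        have hS : S.Nonempty := by
          obtain ⟨x, hx⟩ := this
          exact ⟨x, by simp [S, hx]⟩
        refine ⟨S.min' hS, ?_, ?_⟩
        · have := S.min'_mem hS
          simpa [S] using this
        · intro y hy
          by_contra hcon
          exact absurd (S.min'_le y (by simp [S, hcon])) (not_le.mpr hy)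
      have hge : (x : ℕ) < f x := by
        refine lt_of_le_of_ne ?_ (Ne.symm hx)
        have hind : ∀ m : ℕ, ∀ hm : m < k, m ≤ (f ⟨m, hm⟩ : ℕ) := by
          intro m
          induction m with
          | zero => intro _; omega
          | succ m ihm =>
            intro hm
            have h1 := ihm (by omega)
            have h2 : f ⟨m, by omega⟩ < f ⟨m + 1, hm⟩ := hf (by simp [Fin.lt_def])
            have h3 : (f ⟨m, by omega⟩ : ℕ) < f ⟨m + 1, hm⟩ := h2
            omega
        exact hind x x.2
      let b : Fin n := ⟨(f x : ℕ) - 1, by have := (f x).2; omega⟩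
      have hadj : Adj (f x) b := Or.inr (by simp only [b]; omega)
      have hb : ∀ y, f y ≠ b := by
        intro y hy
        have hyv : (f y : ℕ) = f x - 1 := by rw [hy]
        rcases lt_trichotomy y x with h | h | h
        · have h1 := hmin y h
          have h2 : (y : ℕ) < x := h
          omega
        · subst h; omega
        · have h2 : (f x : ℕ) < f y := hf h
          omega
      have hsm := update_strictMono f hf x b hadj hb
      rw [hQ f hf x b hadj hb]
      refine ih (∑ y, ((Function.update f x b y : Fin n) : ℕ)) ?_ _ hsm rfl
      rw [← hs]
      refine Finset.sum_lt_sum (fun y _ => ?_) ⟨x, Finset.mem_univ _, ?_⟩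
      · by_cases hy : y = x
        · subst hy; simp [b]
        · rw [Function.update_of_ne hy]
      · simp only [Function.update_self, b]; omega

/-- all left minors nonnegative, and for each size some is nonzero -/
def NN {n : ℕ} (M : Matrix (Fin n) (Fin n) ℝ) : Prop :=
  ∀ k (hk : k ≤ n), (∀ f : Fin k → Fin n, StrictMono f → 0 ≤ DM hk M f) ∧
    ∃ f : Fin k → Fin n, StrictMono f ∧ DM hk M f ≠ 0

def PP {n : ℕ} (M : Matrix (Fin n) (Fin n) ℝ) : Prop :=
  ∀ k (hk : k ≤ n), (∀ f : Fin k → Fin n, StrictMono f → 0 < DM hk M f)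

theorem DM_adj_le {n k : ℕ} (hk : k ≤ n) (M : Matrix (Fin n) (Fin n) ℝ) (hM : NN M)
    (f : Fin k → Fin n) (hf : StrictMono f) (a b : Fin n) (hab : Adj a b) (t : ℝ) (ht : 0 ≤ t) :
    DM hk M f ≤ DM hk (Matrix.transvection a b t * M) f := by
  rcases DM_adj_cases hk M f hf a b hab t with h | ⟨f', hf', h⟩
  · rw [h]
  · rw [h]
    have := mul_nonneg ht ((hM k hk).1 f' hf')
    linarith

theorem NN.transvection {n : ℕ} {M : Matrix (Fin n) (Fin n) ℝ} (hM : NN M)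
    (a b : Fin n) (hab : Adj a b) (t : ℝ) (ht : 0 ≤ t) : NN (Matrix.transvection a b t * M) := by
  intro k hk
  refine ⟨fun f hf => ((hM k hk).1 f hf).trans (DM_adj_le hk M hM f hf a b hab t ht), ?_⟩
  obtain ⟨f, hf, h⟩ := (hM k hk).2
  refine ⟨f, hf, ?_⟩
  have h1 : 0 < DM hk M f := lt_of_le_of_ne ((hM k hk).1 f hf) (Ne.symm h)
  exact (lt_of_lt_of_le h1 (DM_adj_le hk M hM f hf a b hab t ht)).ne'

open Classical in
/-- the set of vanishing left minors -/
noncomputable def zeros {n : ℕ} (M : Matrix (Fin n) (Fin n) ℝ) :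
    Finset (Σ k : Fin (n + 1), (Fin (k : ℕ) → Fin n)) :=
  Finset.univ.filter fun p => StrictMono p.2 ∧ DM (Nat.lt_succ_iff.1 p.1.2) M p.2 = 0

theorem NN_mem_closure {n : ℕ} (M : Matrix (Fin n) (Fin n) ℝ) (hM : NN M) :
    M ∈ closure {M : Matrix (Fin n) (Fin n) ℝ | PP M} := by
  induction hs : (zeros M).card using Nat.strong_induction_on generalizing M with
  | _ s ih =>
    by_cases hP : PP M
    · exact subset_closure hP
    · unfold PP at hP
      push Not at hP
      obtain ⟨k, hk, f0, hf0, hz⟩ := hP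
      have hz' : DM hk M f0 = 0 := le_antisymm hz ((hM k hk).1 f0 hf0)
      obtain ⟨f1, hf1, hnz⟩ := (hM k hk).2
      -- there is an adjacent pair
      have hex : ∃ f : Fin k → Fin n, ∃ f' : Fin k → Fin n, ∃ a b : Fin n, ∃ x, StrictMono f ∧
          StrictMono f' ∧ Adj a b ∧ f x = a ∧ f' = Function.update f x b ∧ 
          DM hk M f = 0 ∧ DM hk M f' ≠ 0 := by
        by_contra hcon
        have hQ := strictMono_connect hk (fun f => DM hk M f = 0) (by
          intro f hf x b hab hb
          have hsm := update_strictMono f hf x b hab hb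
          constructor
          · intro h
            by_contra h'
            exact hcon ⟨f, _, f x, b, x, hf, hsm, hab, rfl, rfl, h, h'⟩
          · intro h
            by_contra h'
            refine hcon ⟨Function.update f x b, f, b, f x, x, hsm, hf, hab.symm, by simp, ?_, h, h'⟩
            simp)
        exact hnz ((hQ f1 hf1).2 ((hQ f0 hf0).1 hz'))
      obtain ⟨f, f', a, b, x, hf, hf', hab, hx, hff', h0, h1⟩ := hex
      have hcont : Continuous fun t : ℝ => Matrix.transvection a b t * M := by
        have : Continuous fun t : ℝ => Matrix.transvection a b t := by
          refine continuous_matrix fun i j => ?_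
          simp only [Matrix.transvection, Matrix.add_apply, Matrix.single_apply]
          split_ifs <;> fun_prop
        exact this.matrix_mul continuous_const
      have hmem : ∀ t ∈ Set.Ioi (0 : ℝ), Matrix.transvection a b t * M ∈
          closure {M : Matrix (Fin n) (Fin n) ℝ | PP M} := by
        intro t ht
        have ht' : (0 : ℝ) < t := ht
        have hNN := hM.transvection a b hab t ht'.le
        refine ih (zeros (Matrix.transvection a b t * M)).card ?_ _ hNN rfl
        rw [← hs]
        refine Finset.card_lt_card ?_
        rw [Finset.ssubset_iff_of_subset]
        · refine ⟨⟨⟨k, Nat.lt_succ_iff.2 hk⟩, f⟩, ?_, ?_⟩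
          · simp only [zeros, Finset.mem_filter, Finset.mem_univ, true_and]
            exact ⟨hf, h0⟩
          · simp only [zeros, Finset.mem_filter, Finset.mem_univ, true_and, not_and]
            intro _ 
            have := DM_row_op hk M f hf.injective a b t x hx
            rw [h0, ← hff', zero_add] at this
            intro h2
            rw [this] at h2
            exact (mul_ne_zero ht'.ne' h1) h2
        · rintro ⟨k', g⟩ hg
          simp only [zeros, Finset.mem_filter, Finset.mem_univ, true_and] at hg ⊢
          refine ⟨hg.1, le_antisymm ?_ ((hM _ _).1 g hg.1)⟩
          have := DM_adj_le (Nat.lt_succ_iff.1 k'.2) M hM g hg.1 a b hab t ht'.le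
          rw [hg.2] at this
          exact this
      have h00 : Matrix.transvection a b (0 : ℝ) * M = M := by simp
      have : (0 : ℝ) ∈ closure (Set.Ioi (0 : ℝ)) := by simp
      have h3 := map_mem_closure hcont this hmem
      rw [h00, closure_closure] at h3
      exact h3

/-- multiplication by upper triangular matrix on the right -/
theorem DM_mul_upper {n k : ℕ} (hk : k ≤ n) (M U : Matrix (Fin n) (Fin n) ℝ)
    (hU : ∀ i j, j < i → U i j = 0) (f : Fin k → Fin n) :
    DM hk (M * U) f = DM hk M f * ∏ b : Fin k, U (Fin.castLE hk b) (Fin.castLE hk b) := by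
  have h1 : (Matrix.of fun a b : Fin k => (M * U) (f a) (Fin.castLE hk b)) =
      (Matrix.of fun a b : Fin k => M (f a) (Fin.castLE hk b)) *
      (Matrix.of fun a b : Fin k => U (Fin.castLE hk a) (Fin.castLE hk b)) := by
    ext a b
    simp only [Matrix.of_apply, Matrix.mul_apply]
    have : ∑ j, M (f a) j * U j (Fin.castLE hk b) =
        ∑ j ∈ Finset.univ.map (Fin.castLEEmb hk), M (f a) j * U j (Fin.castLE hk b) := by
      symm
      apply Finset.sum_subset (Finset.subset_univ _)
      intro j _ hj
      rw [hU, mul_zero]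
      by_contra hlt
      apply hj
      simp only [Finset.mem_map, Finset.mem_univ, true_and]
      have : (j : ℕ) < k := by
        have h1 := b.2
        simp only [Fin.lt_def, Fin.val_castLE] at hlt
        omega
      exact ⟨⟨j, this⟩, by ext; simp⟩
    rw [this, Finset.sum_map]
    rfl
  unfold DM
  rw [h1, Matrix.det_mul]
  congr 1
  rw [Matrix.det_of_isUpperTriangular]
  · simp
  · intro i j hij
    exact hU _ _ (by simpa using hij)

end MinorPart

section GSPart

/-- columns as Euclidean vectors -/
noncomputable def colsE {n : ℕ} (M : Matrix (Fin n) (Fin n) ℝ) (k : Fin n) : EuclideanSpace ℝ (Fin n) :=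
  WithLp.toLp 2 (fun i => M i k)

/-- Gram-Schmidt on the columns -/
noncomputable def gsMat {n : ℕ} (M : Matrix (Fin n) (Fin n) ℝ) : Matrix (Fin n) (Fin n) ℝ :=
  Matrix.of fun i k => (InnerProductSpace.gramSchmidtNormed ℝ (colsE M) k) i

theorem colsE_inner {n : ℕ} (M M' : Matrix (Fin n) (Fin n) ℝ) (j k : Fin n) :
    inner ℝ (colsE M j) (colsE M' k) = (M.transpose * M') j k := by
  simp [colsE, Matrix.mul_apply, PiLp.inner_apply, mul_comm]

theorem colsE_gsMat {n : ℕ} (M : Matrix (Fin n) (Fin n) ℝ) (k : Fin n) :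
    colsE (gsMat M) k = InnerProductSpace.gramSchmidtNormed ℝ (colsE M) k := by
  ext i; simp [colsE, gsMat]

theorem colsE_linInd {n : ℕ} (M : Matrix (Fin n) (Fin n) ℝ) (h : M.det ≠ 0) :
    LinearIndependent ℝ (colsE M) := by
  have h1 : LinearIndependent ℝ M.col := Matrix.linearIndependent_cols_of_det_ne_zero h
  exact h1.map' (WithLp.linearEquiv 2 ℝ (Fin n → ℝ)).symm.toLinearMap (LinearEquiv.ker _)

theorem gsMat_orth {n : ℕ} (M : Matrix (Fin n) (Fin n) ℝ) (h : M.det ≠ 0) :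
    (gsMat M).transpose * gsMat M = 1 := by
  have h1 := InnerProductSpace.gramSchmidtNormed_orthonormal (colsE_linInd M h)
  rw [orthonormal_iff_ite] at h1
  ext j k
  rw [← colsE_inner, colsE_gsMat, colsE_gsMat, h1, Matrix.one_apply]

theorem gsMat_upper {n : ℕ} (M : Matrix (Fin n) (Fin n) ℝ) (j k : Fin n) (hjk : k < j) :
    ((gsMat M).transpose * M) j k = 0 := by
  rw [← colsE_inner, colsE_gsMat, InnerProductSpace.gramSchmidtNormed, inner_smul_left,
    InnerProductSpace.gramSchmidt_inv_triangular ℝ _ hjk, mul_zero]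

theorem gsMat_diag_pos {n : ℕ} (M : Matrix (Fin n) (Fin n) ℝ) (h : M.det ≠ 0) (k : Fin n) :
    0 < ((gsMat M).transpose * M) k k := by
  have hne := InnerProductSpace.gramSchmidt_ne_zero k (colsE_linInd M h)
  have hpos : 0 < ‖InnerProductSpace.gramSchmidt ℝ (colsE M) k‖ := norm_pos_iff.2 hne
  rw [← colsE_inner, colsE_gsMat, InnerProductSpace.gramSchmidtNormed, inner_smul_left]
  have : inner ℝ (InnerProductSpace.gramSchmidt ℝ (colsE M) k) (colsE M k) =
      ‖InnerProductSpace.gramSchmidt ℝ (colsE M) k‖ ^ 2 := by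
    conv_lhs => rw [InnerProductSpace.gramSchmidt_def'' ℝ (colsE M) k]
    rw [inner_add_right, inner_sum, Finset.sum_eq_zero, real_inner_self_eq_norm_sq, add_zero]
    intro i hi
    rw [inner_smul_right, InnerProductSpace.gramSchmidt_orthogonal ℝ _ (Finset.mem_Iio.1 hi).ne',
      mul_zero]
  rw [this]
  simp only [RCLike.ofReal_real_eq_id, id, map_inv₀, conj_trivial]
  positivity

theorem gsMat_PP {n : ℕ} (M : Matrix (Fin n) (Fin n) ℝ) (hM : PP M) (h : M.det ≠ 0) :
    PP (gsMat M) := by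
  intro k hk f hf
  have h1 : gsMat M * ((gsMat M).transpose * M) = M := by
    rw [← Matrix.mul_assoc, mul_eq_one_comm.1 (gsMat_orth M h), Matrix.one_mul]
  have h2 := DM_mul_upper hk (gsMat M) ((gsMat M).transpose * M)
    (fun i j hij => gsMat_upper M i j hij) f
  rw [h1] at h2
  have h3 := hM k hk f hf
  rw [h2] at h3
  exact pos_of_mul_pos_left h3 (Finset.prod_nonneg fun b _ => (gsMat_diag_pos M h _).le)

theorem PP_det {n : ℕ} (M : Matrix (Fin n) (Fin n) ℝ) (hM : PP M) : M.det ≠ 0 := by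
  have := hM n le_rfl id strictMono_id
  have h2 : DM le_rfl M id = M.det := by
    unfold DM; congr 1
  rw [h2] at this
  exact this.ne'

theorem gs_continuousAt {n : ℕ} (M : Matrix (Fin n) (Fin n) ℝ) (h : M.det ≠ 0) (k : Fin n) :
    ContinuousAt (fun X : Matrix (Fin n) (Fin n) ℝ => InnerProductSpace.gramSchmidt ℝ (colsE X) k) M := by
  have hcol : ∀ k, Continuous fun X : Matrix (Fin n) (Fin n) ℝ => colsE X k := by
    intro k
    unfold colsE
    fun_prop
  induction k using WellFoundedLT.induction with
  | _ k ih =>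
    have hd : (fun X : Matrix (Fin n) (Fin n) ℝ => InnerProductSpace.gramSchmidt ℝ (colsE X) k) =
        fun X => colsE X k - ∑ i ∈ Finset.Iio k,
          (inner ℝ (InnerProductSpace.gramSchmidt ℝ (colsE X) i) (colsE X k) /
            (‖InnerProductSpace.gramSchmidt ℝ (colsE X) i‖ : ℝ) ^ 2) •
              InnerProductSpace.gramSchmidt ℝ (colsE X) i := by
      funext X
      rw [eq_sub_iff_add_eq]
      exact (InnerProductSpace.gramSchmidt_def'' ℝ (colsE X) k).symm
    rw [hd]
    refine (hcol k).continuousAt.sub (tendsto_finsetSum _ fun i hi => ?_)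
    have hi' := ih i (Finset.mem_Iio.1 hi)
    have hne := InnerProductSpace.gramSchmidt_ne_zero i (colsE_linInd M h)
    refine ContinuousAt.smul (ContinuousAt.div (hi'.inner (𝕜 := ℝ) (hcol k).continuousAt)
      (hi'.norm.pow 2) ?_) hi'
    exact pow_ne_zero 2 (norm_ne_zero_iff.2 hne)

theorem gsMat_continuousAt {n : ℕ} (M : Matrix (Fin n) (Fin n) ℝ) (h : M.det ≠ 0) :
    ContinuousAt (gsMat (n := n)) M := by
  refine continuousAt_pi.2 fun i => continuousAt_pi.2 fun k => ?_
  have h1 := gs_continuousAt M h k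
  have hne := InnerProductSpace.gramSchmidt_ne_zero k (colsE_linInd M h)
  have h2 : ContinuousAt (fun X : Matrix (Fin n) (Fin n) ℝ =>
      InnerProductSpace.gramSchmidtNormed ℝ (colsE X) k) M := by
    unfold InnerProductSpace.gramSchmidtNormed
    exact (h1.norm.inv₀ (norm_ne_zero_iff.2 hne)).smul h1
  have h3 : Continuous fun x : EuclideanSpace ℝ (Fin n) => x i := by fun_prop
  exact h3.continuousAt.comp h2

theorem gsMat_of_orth {n : ℕ} (M : Matrix (Fin n) (Fin n) ℝ) (h : M.transpose * M = 1) :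
    gsMat M = M := by
  have h1 : InnerProductSpace.gramSchmidt ℝ (colsE M) = colsE M := by
    apply InnerProductSpace.gramSchmidt_of_orthogonal
    intro j k hjk
    change inner ℝ (colsE M j) (colsE M k) = 0
    rw [colsE_inner, h, Matrix.one_apply_ne hjk]
  have h2 : ∀ k, ‖colsE M k‖ = 1 := by
    intro k
    have : ‖colsE M k‖ ^ 2 = 1 := by
      rw [← real_inner_self_eq_norm_sq, colsE_inner, h, Matrix.one_apply_eq]
    nlinarith [norm_nonneg (colsE M k)]
  ext i k
  simp only [gsMat, Matrix.of_apply, InnerProductSpace.gramSchmidtNormed, h1, h2]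
  simp [colsE]

theorem orth_mem_closure {n : ℕ} (g : Matrix (Fin n) (Fin n) ℝ) (hg : g.transpose * g = 1)
    (hN : NN g) :
    g ∈ closure {M : Matrix (Fin n) (Fin n) ℝ | M.transpose * M = 1 ∧ PP M} := by
  have hdet : g.det ≠ 0 := by
    intro h0
    have := congrArg Matrix.det hg
    rw [Matrix.det_mul, h0] at this
    simp at this
  have h1 := (gsMat_continuousAt g hdet).continuousWithinAt (s := {M | PP M}) 
    |>.mem_closure_image (NN_mem_closure g hN)
  rw [gsMat_of_orth g hg] at h1
  refine closure_mono ?_ h1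
  rintro _ ⟨M, hM, rfl⟩
  exact ⟨gsMat_orth M (PP_det M hM), gsMat_PP M hM (PP_det M hM)⟩

/-- sign-consistent version -/
def SN {n : ℕ} (M : Matrix (Fin n) (Fin n) ℝ) : Prop :=
  ∃ τ : ℕ → ℝ, (∀ k, τ k = 1 ∨ τ k = -1) ∧ ∀ k (hk : k ≤ n),
    (∀ f : Fin k → Fin n, StrictMono f → 0 ≤ τ k * DM hk M f) ∧
    ∃ f : Fin k → Fin n, StrictMono f ∧ DM hk M f ≠ 0

theorem SN.fix {n : ℕ} {M : Matrix (Fin n) (Fin n) ℝ} (hM : SN M) :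
    ∃ ε : Fin n → ℝ, (∀ k, ε k = 1 ∨ ε k = -1) ∧ NN (M * Matrix.diagonal ε) := by
  obtain ⟨τ, hτ, h⟩ := hM
  have hsq : ∀ k, τ k * τ k = 1 := by
    intro k; rcases hτ k with h | h <;> rw [h] <;> norm_num
  have hne : ∀ k, τ k ≠ 0 := by
    intro k; rcases hτ k with h | h <;> rw [h] <;> norm_num
  have h0 : τ 0 = 1 := by
    have h1 := (h 0 (Nat.zero_le n)).1 (fun x => x.elim0) (fun x => x.elim0)
    have h2 : DM (Nat.zero_le n) M (fun x => x.elim0) = 1 := by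
      unfold DM; exact Matrix.det_isEmpty
    rw [h2] at h1
    rcases hτ 0 with h | h
    · exact h
    · rw [h] at h1; norm_num at h1
  refine ⟨fun k => τ (k + 1) * τ k, fun k => ?_, fun k hk => ?_⟩
  · rcases hτ k with h | h <;> rcases hτ (k + 1) with h' | h' <;> simp [h, h']
  · have key : ∀ f, DM hk (M * Matrix.diagonal fun k : Fin n => τ (k + 1) * τ k) f = τ k * DM hk M f := by
      intro f
      rw [DM_mul_upper hk _ _ (fun i j hij => Matrix.diagonal_apply_ne _ hij.ne')]
      simp only [Matrix.diagonal_apply_eq, Fin.val_castLE]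
      rw [Fin.prod_univ_eq_prod_range (fun i => τ (i + 1) * τ i) k, mul_comm]
      congr 1
      clear h
      clear hk f
      induction k with
      | zero => simp [h0]
      | succ k ih => rw [Finset.prod_range_succ, ih, mul_comm, mul_assoc, hsq, mul_one]
    obtain ⟨h1, f, hf, h2⟩ := h k hk
    refine ⟨fun f hf => by rw [key]; exact h1 f hf, f, hf, ?_⟩
    rw [key]
    exact mul_ne_zero (hne k) h2

/-- the orbit map over the reals -/
noncomputable def orbMap {n : ℕ} (lam : Fin n → ℝ) (g : Matrix (Fin n) (Fin n) ℝ) :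
    Matrix (Fin n) (Fin n) ℂ :=
  g.map Complex.ofReal * (Complex.I • Matrix.diagonal (fun i => (lam i : ℂ))) *
    (g.map Complex.ofReal).conjTranspose

theorem SN_orbMap_mem {n : ℕ} (lam : Fin n → ℝ) (g : Matrix (Fin n) (Fin n) ℝ)
    (hg : g.transpose * g = 1) (hS : SN g) : orbMap lam g ∈ SkewOrbitTNN lam := by
  obtain ⟨ε, hε, hNN⟩ := hS.fix
  have hεsq : ∀ k, ε k * ε k = 1 := by
    intro k; rcases hε k with h | h <;> rw [h] <;> norm_num
  have hεd : Matrix.diagonal ε * Matrix.diagonal ε = 1 := by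
    rw [Matrix.diagonal_mul_diagonal]
    simp [hεsq]
  have ho : (g * Matrix.diagonal ε).transpose * (g * Matrix.diagonal ε) = 1 := by
    rw [Matrix.transpose_mul, Matrix.diagonal_transpose, Matrix.mul_assoc,
      ← Matrix.mul_assoc g.transpose, hg, Matrix.one_mul, hεd]
  have hcl := orth_mem_closure _ ho hNN
  have hcont : Continuous (orbMap (n := n) lam) := by
    have h1 : Continuous fun g : Matrix (Fin n) (Fin n) ℝ => g.map Complex.ofReal :=
      continuous_id.matrix_map Complex.continuous_ofReal
    unfold orbMap
    exact (h1.matrix_mul continuous_const).matrix_mul h1.matrix_conjTranspose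
  have heq : orbMap lam (g * Matrix.diagonal ε) = orbMap lam g := by
    have h1 : (g * Matrix.diagonal ε).map Complex.ofReal =
        g.map Complex.ofReal * Matrix.diagonal (fun k => (ε k : ℂ)) := by
      ext i j
      simp [Matrix.mul_diagonal]
    unfold orbMap
    rw [h1, Matrix.conjTranspose_mul, Matrix.diagonal_conjTranspose]
    simp only [Matrix.mul_assoc]
    congr 1
    rw [← Matrix.mul_assoc, ← Matrix.mul_assoc]
    congr 1
    rw [Matrix.mul_smul, Matrix.smul_mul, Matrix.diagonal_mul_diagonal, Matrix.diagonal_mul_diagonal]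
    congr 2
    funext k
    simp only [Pi.star_apply, RCLike.star_def, Complex.conj_ofReal]
    rw [mul_comm, ← mul_assoc, ← Complex.ofReal_mul, hεsq]
    simp
  rw [← heq]
  unfold SkewOrbitTNN
  refine map_mem_closure hcont hcl ?_
  rintro M ⟨hM1, hM2⟩
  refine ⟨M.map Complex.ofReal, ⟨?_, fun I => ?_⟩, rfl⟩
  · ext i j
    have := congrFun (congrFun hM1 i) j
    simp only [Matrix.mul_apply, Matrix.transpose_apply] at this
    simp only [Matrix.mul_apply, Matrix.conjTranspose_apply, Matrix.map_apply, RCLike.star_def,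
      Complex.conj_ofReal]
    have h2 : (1 : Matrix (Fin n) (Fin n) ℂ) i j = (((1 : Matrix (Fin n) (Fin n) ℝ) i j : ℝ) : ℂ) := by
      simp only [Matrix.one_apply]; split_ifs <;> simp
    rw [h2, ← this]
    push_cast
    rfl
  · have hI : I.card ≤ n := by simpa using Finset.card_le_univ I
    have h1 := hM2 I.card hI (I.orderEmbOfFin rfl) (I.orderEmbOfFin rfl).strictMono
    rw [leftMinor_eq_DM _ I hI]
    have h2 : DM hI (M.map Complex.ofReal) (I.orderEmbOfFin rfl) =
        ((DM hI M (I.orderEmbOfFin rfl) : ℝ) : ℂ) := by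
      unfold DM
      rw [← Complex.ofRealHom_eq_coe, RingHom.map_det]
      rfl
    rw [h2]
    exact ⟨by simpa using h1, by simp⟩

end GSPart

section CondPart

open Polynomial

theorem isClosed_nonnegReal : IsClosed {z : ℂ | IsNonnegReal z} := by
  have h : {z : ℂ | IsNonnegReal z} = {z : ℂ | 0 ≤ z.re} ∩ {z : ℂ | z.im = 0} := rfl
  rw [h]
  exact (isClosed_le continuous_const Complex.continuous_re).inter
    (isClosed_eq Complex.continuous_im continuous_const)

theorem IsNonnegReal.mul {a b : ℂ} (ha : IsNonnegReal a) (hb : IsNonnegReal b) :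
    IsNonnegReal (a * b) := by
  refine ⟨?_, ?_⟩
  · rw [Complex.mul_re, ha.2, hb.2]; simpa using mul_nonneg ha.1 hb.1
  · rw [Complex.mul_im, ha.2, hb.2]; simp

theorem deriv_nonnegReal (h : ℝ → ℂ) (d : ℂ) (hd : HasDerivAt h d 0) (h0 : h 0 = 0)
    (hp : ∀ t, 0 ≤ t → IsNonnegReal (h t)) : IsNonnegReal d := by
  have h1 := (hasDerivAt_iff_tendsto_slope.1 hd)
  have h2 : Filter.Tendsto (slope h 0) (nhdsWithin 0 (Set.Ioi 0)) (nhds d) :=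
    h1.mono_left (nhdsWithin_mono _ (fun x hx => ne_of_gt hx))
  refine isClosed_nonnegReal.mem_of_tendsto h2 ?_
  filter_upwards [self_mem_nhdsWithin] with t ht
  have ht' : (0 : ℝ) < t := ht
  change IsNonnegReal (slope h 0 t)
  rw [slope_def_module, h0, sub_zero, sub_zero, Complex.real_smul]
  refine IsNonnegReal.mul ⟨?_, ?_⟩ (hp t ht'.le)
  · rw [Complex.ofReal_re]; positivity
  · simp

theorem aeval_conj {n : ℕ} (U : Matrix (Fin n) (Fin n) ℂ) (hU : U.conjTranspose * U = 1)
    (d : Fin n → ℂ) (p : ℂ[X]) :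
    aeval (U * Matrix.diagonal d * U.conjTranspose) p =
      U * Matrix.diagonal (fun k => p.eval (d k)) * U.conjTranspose := by
  have hU' : U * U.conjTranspose = 1 := mul_eq_one_comm.1 hU
  induction p using Polynomial.induction_on' with
  | add p q hp hq =>
    rw [map_add, hp, hq]
    simp only [eval_add]
    rw [← Matrix.add_mul, ← Matrix.mul_add, Matrix.diagonal_add]
  | monomial m a =>
    rw [aeval_monomial]
    have hpow : ∀ m : ℕ, (U * Matrix.diagonal d * U.conjTranspose) ^ m =
        U * Matrix.diagonal (fun k => d k ^ m) * U.conjTranspose := by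
      intro m
      induction m with
      | zero => simp [hU']
      | succ m ih =>
        rw [pow_succ, ih]
        have : U * Matrix.diagonal (fun k => d k ^ m) * U.conjTranspose *
            (U * Matrix.diagonal d * U.conjTranspose) =
            U * Matrix.diagonal (fun k => d k ^ m) * (U.conjTranspose * U) *
              Matrix.diagonal d * U.conjTranspose := by
          simp only [Matrix.mul_assoc]
        rw [this, hU, Matrix.mul_one, Matrix.mul_assoc U, Matrix.diagonal_mul_diagonal]
        simp only [pow_succ]
    rw [hpow, ← Algebra.smul_def, ← Matrix.smul_mul, ← Matrix.mul_smul, ← Matrix.diagonal_smul]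
    simp only [eval_monomial]
    rfl

theorem aeval_EHD {n : ℕ} (L : ℝ → Matrix (Fin n) (Fin n) ℂ) (M : Matrix (Fin n) (Fin n) ℂ) (t : ℝ)
    (hL : EHD L (M * L t - L t * M) t) (p : ℂ[X]) :
    EHD (fun s => aeval (L s) p) (M * aeval (L t) p - aeval (L t) p * M) t := by
  induction p using Polynomial.induction_on with
  | C a =>
    simp only [aeval_C]
    rw [Algebra.commutes a M, sub_self]
    exact EHD.const _ t
  | add p q hp hq =>
    simp only [map_add]
    have := hp.add hq
    convert this using 1
    noncomm_ring
  | monomial m a ih =>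
    have h1 : (C a * X ^ (m + 1) : ℂ[X]) = C a * X ^ m * X := by ring
    rw [h1]
    simp only [map_mul _ _ X, aeval_X]
    have := ih.mul hL
    convert this using 1
    noncomm_ring

theorem aeval_continuous {n : ℕ} (p : ℂ[X]) :
    Continuous fun L : Matrix (Fin n) (Fin n) ℂ => aeval L p := by
  induction p using Polynomial.induction_on with
  | C a => simp only [aeval_C]; exact continuous_const
  | add p q hp hq => simp only [map_add]; exact hp.add hq
  | monomial m a ih =>
    have h1 : (C a * X ^ (m + 1) : ℂ[X]) = C a * X ^ m * X := by ring
    rw [h1]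
    simp only [map_mul _ _ X, aeval_X]
    exact ih.matrix_mul continuous_id

/-- Lagrange polynomial selecting an eigenvalue -/
noncomputable def lagP {n : ℕ} (lam : Fin n → ℝ) (k0 : Fin n) : ℂ[X] :=
  Lagrange.basis Finset.univ (fun k => Complex.I * (lam k : ℂ)) k0

theorem lagP_eval {n : ℕ} (lam : Fin n → ℝ) (hanti : StrictAnti lam) (k0 k : Fin n) :
    (lagP lam k0).eval (Complex.I * (lam k : ℂ)) = if k = k0 then 1 else 0 := by
  have hinj : Set.InjOn (fun k => Complex.I * (lam k : ℂ)) (Finset.univ : Finset (Fin n)) := by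
    intro a _ b _ h
    have h' := mul_left_cancel₀ Complex.I_ne_zero h
    exact hanti.injective (by exact_mod_cast h')
  unfold lagP
  split_ifs with h
  · subst h
    exact Lagrange.eval_basis_self (v := fun k => Complex.I * (lam k : ℂ)) hinj (Finset.mem_univ k)
  · exact Lagrange.eval_basis_of_ne (v := fun k => Complex.I * (lam k : ℂ)) (Ne.symm h)
      (Finset.mem_univ k)

theorem lagP_aeval {n : ℕ} (lam : Fin n → ℝ) (hanti : StrictAnti lam) (k0 : Fin n)
    (U : Matrix (Fin n) (Fin n) ℂ) (hU : U.conjTranspose * U = 1) (i j : Fin n) :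
    (aeval (U * (Complex.I • Matrix.diagonal (fun i => (lam i : ℂ))) * U.conjTranspose)
      (lagP lam k0)) i j = U i k0 * star (U j k0) := by
  have h1 : Complex.I • Matrix.diagonal (fun i => (lam i : ℂ)) =
      Matrix.diagonal (fun i => Complex.I * (lam i : ℂ)) := by
    rw [← Matrix.diagonal_smul]; rfl
  rw [h1, aeval_conj U hU]
  simp only [lagP_eval lam hanti]
  rw [Matrix.mul_apply]
  simp [Matrix.mul_diagonal]

theorem flow_cond {n : ℕ} (lam : Fin n → ℝ) (hanti : StrictAnti lam)
    (N B : Matrix (Fin n) (Fin n) ℂ) (hN : N.conjTranspose = -N) (hNB : N = Complex.I • B)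
    (Hb : ∀ L : ℝ → Matrix (Fin n) (Fin n) ℂ,
      (∀ t : ℝ, ∀ i j : Fin n, HasDerivAt (fun s => L s i j)
        ((L t * (L t * N - N * L t) - (L t * N - N * L t) * L t) i j) t) →
      L 0 ∈ SkewOrbitTNN lam → ∀ t : ℝ, 0 ≤ t → L t ∈ SkewOrbitTNN lam)
    (k0 : Fin n) (σ : Fin n → ℂ)
    (hσ : ∀ U ∈ UnitaryTP n, ∀ i j, IsNonnegReal (σ i * σ j * (U i k0 * star (U j k0))))
    (g : Matrix (Fin n) (Fin n) ℝ) (hg : g.transpose * g = 1) (hS : SN g)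
    (i j : Fin n) (hi : g i k0 = 0) :
    IsNonnegReal (σ i * σ j * (((∑ x, (∑ k, (g i k : ℂ) * lam k * g x k) * (∑ m, B x m * g m k0))
      - lam k0 * ∑ m, B i m * g m k0) * g j k0)) := by
  set U := g.map Complex.ofReal with hUdef
  have hU : U.conjTranspose * U = 1 := by
    ext a b
    have := congrFun (congrFun hg a) b
    simp only [Matrix.mul_apply, Matrix.transpose_apply] at this
    simp only [hUdef, Matrix.mul_apply, Matrix.conjTranspose_apply, Matrix.map_apply, RCLike.star_def,
      Complex.conj_ofReal]
    have h2 : (1 : Matrix (Fin n) (Fin n) ℂ) a b = (((1 : Matrix (Fin n) (Fin n) ℝ) a b : ℝ) : ℂ) := by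
      simp only [Matrix.one_apply]; split_ifs <;> simp
    rw [h2, ← this]
    push_cast
    rfl
  have hU' : U * U.conjTranspose = 1 := mul_eq_one_comm.1 hU
  set L0 := orbMap lam g with hL0
  have hL0' : L0 = U * (Complex.I • Matrix.diagonal (fun i => (lam i : ℂ))) * U.conjTranspose := rfl
  have hskew : L0.conjTranspose = - L0 := by
    rw [hL0']
    simp only [Matrix.conjTranspose_mul, Matrix.conjTranspose_conjTranspose,
      Matrix.conjTranspose_smul, Matrix.diagonal_conjTranspose]
    have : (star fun i => (lam i : ℂ)) = fun i => (lam i : ℂ) := by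
      funext k; simp
    rw [this, ← Matrix.mul_assoc]
    simp
  have hmem : L0 ∈ SkewOrbitTNN lam := SN_orbMap_mem lam g hg hS
  obtain ⟨L, hLz, hL⟩ := flow_exists N hN L0 hskew
  have hstay := Hb L hL (by rw [hLz]; exact hmem)
  -- closed condition
  have hclosed : ∀ X ∈ SkewOrbitTNN lam, IsNonnegReal (σ i * σ j * (aeval X (lagP lam k0)) i j) := by
    have hc : IsClosed {X : Matrix (Fin n) (Fin n) ℂ |
        IsNonnegReal (σ i * σ j * (aeval X (lagP lam k0)) i j)} := by
      apply isClosed_nonnegReal.preimage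
        (f := fun X : Matrix (Fin n) (Fin n) ℂ => σ i * σ j * (aeval X (lagP lam k0)) i j)
      have := (aeval_continuous (n := n) (lagP lam k0)).matrix_elem i j
      exact continuous_const.mul this
    have hsub : SkewOrbitTP lam ⊆ {X : Matrix (Fin n) (Fin n) ℂ |
        IsNonnegReal (σ i * σ j * (aeval X (lagP lam k0)) i j)} := by
      rintro X ⟨V, hV, rfl⟩
      change IsNonnegReal _
      rw [lagP_aeval lam hanti k0 V hV.1]
      exact hσ V hV i j
    exact fun X hX => closure_minimal hsub hc hX
  have hP : ∀ a b, (aeval L0 (lagP lam k0)) a b = (g a k0 : ℂ) * g b k0 := by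
    intro a b
    rw [hL0', lagP_aeval lam hanti k0 U hU]
    simp [hUdef]
  set P := aeval L0 (lagP lam k0) with hPdef
  set M := N * L0 - L0 * N with hM
  have hder : EHD (fun s => aeval (L s) (lagP lam k0)) (M * P - P * M) 0 := by
    have := aeval_EHD L M 0 (by
      have := hL 0
      convert this using 1
      rw [hLz, hM, dbl]
      noncomm_ring) (lagP lam k0)
    rw [hLz] at this
    exact this
  have hfin := deriv_nonnegReal (fun s => σ i * σ j * (aeval (L s) (lagP lam k0)) i j)
    (σ i * σ j * (M * P - P * M) i j) ((hder i j).const_mul _) (by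
      simp only [hLz]
      rw [← hPdef, hP, hi]; simp) (fun t ht => hclosed _ (hstay t ht))
  convert hfin using 2
  have hPM : (P * M) i j = 0 := by
    rw [Matrix.mul_apply]
    refine Finset.sum_eq_zero fun x _ => ?_
    rw [hP, hi]; simp
  have hL0e : ∀ a b, L0 a b = Complex.I * ∑ k, (g a k : ℂ) * lam k * g b k := by
    intro a b
    rw [hL0', Matrix.mul_smul, Matrix.smul_mul, Matrix.smul_apply, smul_eq_mul, Matrix.mul_apply]
    congr 1
    refine Finset.sum_congr rfl fun k _ => ?_
    rw [Matrix.mul_diagonal]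
    simp [hUdef]
  have hLP : L0 * P = (Complex.I * (lam k0 : ℂ)) • P := by
    ext a b
    rw [Matrix.mul_apply, Matrix.smul_apply, smul_eq_mul]
    simp only [hP, hL0e]
    have horth : ∀ k, ∑ x, (g x k : ℂ) * g x k0 = if k = k0 then 1 else 0 := by
      intro k
      have := congrFun (congrFun hU k) k0
      rw [Matrix.mul_apply] at this
      simp only [hUdef, Matrix.conjTranspose_apply, Matrix.map_apply, RCLike.star_def,
        Complex.conj_ofReal, Matrix.one_apply] at this
      exact this
    have : ∀ x, Complex.I * (∑ k, (g a k : ℂ) * lam k * g x k) * (g x k0 * g b k0) =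
        ∑ k, Complex.I * g a k * lam k * g b k0 * (g x k * g x k0) := by
      intro x
      rw [Finset.mul_sum, Finset.sum_mul]
      refine Finset.sum_congr rfl fun k _ => by ring
    simp only [this]
    rw [Finset.sum_comm]
    simp only [← Finset.mul_sum, horth]
    simp
    ring
  have hBP : ∀ x, (B * P) x j = (∑ m, B x m * g m k0) * g j k0 := by
    intro x
    rw [Matrix.mul_apply, Finset.sum_mul]
    refine Finset.sum_congr rfl fun m _ => ?_
    rw [hP]; ring
  have hI : Complex.I * Complex.I = -1 := Complex.I_mul_I
  have e1 : (N * (L0 * P)) i j = -(lam k0 * ((∑ m, B i m * g m k0) * g j k0)) := by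
    rw [hLP, Matrix.mul_smul, Matrix.smul_apply, smul_eq_mul, hNB, Matrix.smul_mul,
      Matrix.smul_apply, smul_eq_mul, hBP]
    linear_combination (lam k0 : ℂ) * ((∑ m, B i m * g m k0) * g j k0) * hI
  have e2 : (L0 * (N * P)) i j = -((∑ x, (∑ k, (g i k : ℂ) * lam k * g x k) *
      (∑ m, B x m * g m k0)) * g j k0) := by
    rw [Matrix.mul_apply, Finset.sum_mul, ← Finset.sum_neg_distrib]
    refine Finset.sum_congr rfl fun x _ => ?_
    rw [hNB, Matrix.smul_mul, Matrix.smul_apply, smul_eq_mul, hBP, hL0e]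
    linear_combination ((∑ k, (g i k : ℂ) * lam k * g x k) *
      ((∑ m, B x m * g m k0) * g j k0)) * hI
  rw [Matrix.sub_apply, hPM, sub_zero, hM, Matrix.sub_mul, Matrix.mul_assoc N, Matrix.mul_assoc L0,
    Matrix.sub_apply, e1, e2]
  ring

end CondPart


section SnPart

theorem SN.intro {n : ℕ} {M : Matrix (Fin n) (Fin n) ℝ}
    (h : ∀ k (hk : k ≤ n), ∃ τ : ℝ, (τ = 1 ∨ τ = -1) ∧
      (∀ f : Fin k → Fin n, StrictMono f → 0 ≤ τ * DM hk M f) ∧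
      ∃ f : Fin k → Fin n, StrictMono f ∧ DM hk M f ≠ 0) : SN M := by
  have h' : ∀ k, ∃ τ : ℝ, (τ = 1 ∨ τ = -1) ∧ ∀ hk : k ≤ n,
      (∀ f : Fin k → Fin n, StrictMono f → 0 ≤ τ * DM hk M f) ∧
      ∃ f : Fin k → Fin n, StrictMono f ∧ DM hk M f ≠ 0 := by
    intro k
    by_cases hk : k ≤ n
    · obtain ⟨τ, h1, h2⟩ := h k hk
      exact ⟨τ, h1, fun _ => h2⟩
    · exact ⟨1, Or.inl rfl, fun h => absurd h hk⟩
  choose τ h1 h2 using h'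
  exact ⟨τ, h1, h2⟩

theorem SN.transvection {n : ℕ} {M : Matrix (Fin n) (Fin n) ℝ} (hM : SN M)
    (a b : Fin n) (hab : Adj a b) (t : ℝ) (ht : 0 ≤ t) : SN (Matrix.transvection a b t * M) := by
  obtain ⟨τ, h1, h2⟩ := hM
  refine ⟨τ, h1, fun k hk => ?_⟩
  have hle : ∀ f : Fin k → Fin n, StrictMono f →
      τ k * DM hk M f ≤ τ k * DM hk (Matrix.transvection a b t * M) f := by
    intro f hf
    rcases DM_adj_cases hk M f hf a b hab t with h | ⟨f', hf', h⟩
    · rw [h]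
    · rw [h]
      have := mul_nonneg ht ((h2 k hk).1 f' hf')
      linarith
  refine ⟨fun f hf => ((h2 k hk).1 f hf).trans (hle f hf), ?_⟩
  obtain ⟨f, hf, h⟩ := (h2 k hk).2
  refine ⟨f, hf, fun h0 => ?_⟩
  have h3 := hle f hf
  rw [h0, mul_zero] at h3
  have h4 := le_antisymm h3 ((h2 k hk).1 f hf)
  rcases mul_eq_zero.1 h4 with h5 | h5
  · rcases h1 k with h6 | h6 <;> rw [h6] at h5 <;> norm_num at h5
  · exact h h5

theorem SN.mul_upper {n : ℕ} {M : Matrix (Fin n) (Fin n) ℝ} (hM : SN M)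
    (U : Matrix (Fin n) (Fin n) ℝ) (hU : ∀ i j, j < i → U i j = 0) (hd : ∀ i, U i i ≠ 0) :
    SN (M * U) := by
  obtain ⟨τ, h1, h2⟩ := hM
  refine SN.intro fun k hk => ?_
  have hne : ∏ b : Fin k, U (Fin.castLE hk b) (Fin.castLE hk b) ≠ 0 :=
    Finset.prod_ne_zero_iff.2 fun b _ => hd _
  have hex : ∃ f : Fin k → Fin n, StrictMono f ∧ DM hk (M * U) f ≠ 0 := by
    obtain ⟨f, hf, h⟩ := (h2 k hk).2
    exact ⟨f, hf, by rw [DM_mul_upper hk M U hU f]; exact mul_ne_zero h hne⟩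
  rcases lt_or_gt_of_ne hne with hp | hp
  · refine ⟨-τ k, ?_, fun f hf => ?_, hex⟩
    · rcases h1 k with h | h <;> rw [h] <;> norm_num
    · rw [DM_mul_upper hk M U hU f]
      have := mul_nonneg ((h2 k hk).1 f hf) (neg_nonneg.2 hp.le)
      linarith
  · refine ⟨τ k, h1 k, fun f hf => ?_, hex⟩
    rw [DM_mul_upper hk M U hU f]
    have := mul_nonneg ((h2 k hk).1 f hf) hp.le
    linarith

theorem SN_perm {n : ℕ} (w : Fin n ≃ Fin n) (M : Matrix (Fin n) (Fin n) ℝ)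
    (hM : ∀ i k, M i k = if i = w k then 1 else 0) : SN M := by
  refine SN.intro fun k hk => ?_
  have hinj : Function.Injective (fun b : Fin k => w (Fin.castLE hk b)) :=
    w.injective.comp (Fin.castLE_injective hk)
  set I := Finset.univ.image (fun b : Fin k => w (Fin.castLE hk b)) with hI
  have hc : I.card = k := by rw [hI, Finset.card_image_of_injective _ hinj]; simp
  set f0 := I.orderEmbOfFin hc with hf0
  have huniq : ∀ f : Fin k → Fin n, StrictMono f → DM hk M f ≠ 0 → f = f0 := by
    intro f hf h
    refine Finset.orderEmbOfFin_unique hc (fun x => ?_) hf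
    by_contra hx
    apply h
    unfold DM
    refine Matrix.det_eq_zero_of_row_eq_zero x fun b => ?_
    simp only [Matrix.of_apply, hM]
    rw [if_neg]
    intro hb
    exact hx (by rw [hI, hb]; simp)
  have hne : DM hk M f0 ≠ 0 := by
    unfold DM
    intro h0
    set X := (Matrix.of fun a b : Fin k => M (f0 a) (Fin.castLE hk b)) with hX
    have hXX : X.transpose * X = 1 := by
      ext b c
      rw [Matrix.mul_apply]
      have hb : w (Fin.castLE hk b) ∈ I := by rw [hI]; simp
      have : w (Fin.castLE hk b) ∈ Set.range f0 := by
        rw [hf0, Finset.range_orderEmbOfFin]; exact hb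
      obtain ⟨a, ha⟩ := this
      rw [Finset.sum_eq_single a]
      · simp only [hX, Matrix.transpose_apply, Matrix.of_apply, hM, ha, if_true, one_mul,
          Matrix.one_apply]
        simp
      · intro a' _ ha'
        simp only [hX, Matrix.transpose_apply, Matrix.of_apply, hM]
        rw [if_neg, zero_mul]
        rw [← ha]
        exact fun h => ha' (f0.injective h)
      · simp
    have := congrArg Matrix.det hXX
    rw [Matrix.det_mul, h0, mul_zero, Matrix.det_one] at this
    exact zero_ne_one this
  have hex : ∃ f : Fin k → Fin n, StrictMono f ∧ DM hk M f ≠ 0 := ⟨f0, f0.strictMono, hne⟩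
  rcases lt_or_gt_of_ne hne with hp | hp
  · refine ⟨-1, Or.inr rfl, fun f hf => ?_, hex⟩
    by_cases h : DM hk M f = 0
    · rw [h]; simp
    · rw [huniq f hf h]; linarith
  · refine ⟨1, Or.inl rfl, fun f hf => ?_, hex⟩
    by_cases h : DM hk M f = 0
    · rw [h]; simp
    · rw [huniq f hf h]; linarith

theorem sign_first {n : ℕ} (k0 : Fin n) (hk0 : (k0 : ℕ) = 0) (U : Matrix (Fin n) (Fin n) ℂ)
    (hU : U ∈ UnitaryTP n) (i j : Fin n) :
    IsNonnegReal ((fun _ => (1 : ℂ)) i * (fun _ => (1 : ℂ)) j * (U i k0 * star (U j k0))) := by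
  have key : ∀ i, IsPosReal (U i k0) := by
    intro i
    have h1 : 1 ≤ n := by have := i.2; omega
    have h2 := DM_eq_leftMinor h1 U (fun _ => i) (Subsingleton.strictMono _)
    have h3 := hU.2 (Finset.univ.image (fun _ : Fin 1 => i))
    rw [← h2] at h3
    unfold DM at h3
    rw [Matrix.det_fin_one] at h3
    simp only [Matrix.of_apply] at h3
    have : Fin.castLE h1 0 = k0 := by ext; simp [hk0]
    rwa [this] at h3
  have hi := key i
  have hj := key j
  simp only [one_mul]
  refine IsNonnegReal.mul ⟨hi.1.le, hi.2⟩ ⟨?_, ?_⟩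
  · simpa using hj.1.le
  · simpa using hj.2

theorem IsPosReal.eq {z : ℂ} (h : IsPosReal z) : ∃ r : ℝ, 0 < r ∧ z = r :=
  ⟨z.re, h.1, Complex.ext (by simp) (by simpa using h.2)⟩

theorem sign_last {n : ℕ} (k0 : Fin n) (hk0 : (k0 : ℕ) + 1 = n) (U : Matrix (Fin n) (Fin n) ℂ)
    (hU : U ∈ UnitaryTP n) (i j : Fin n) :
    IsNonnegReal ((fun x : Fin n => (-1 : ℂ) ^ (x : ℕ)) i * (fun x : Fin n => (-1 : ℂ) ^ (x : ℕ)) j *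
      (U i k0 * star (U j k0))) := by
  obtain ⟨m, rfl⟩ : ∃ m, n = m + 1 := ⟨k0, hk0.symm⟩
  have hk : k0 = Fin.last m := by ext; simp; omega
  subst hk
  obtain ⟨D, hD, hDe⟩ : ∃ r : ℝ, 0 < r ∧ U.det = r := by
    have h1 := hU.2 (Finset.univ.image (id : Fin (m + 1) → Fin (m + 1)))
    rw [← DM_eq_leftMinor le_rfl U id strictMono_id] at h1
    exact h1.eq
  have hmin : ∀ i : Fin (m + 1), ∃ r : ℝ, 0 < r ∧
      (U.submatrix i.succAbove (Fin.last m).succAbove).det = r := by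
    intro i
    have h1 := hU.2 (Finset.univ.image i.succAbove)
    rw [← DM_eq_leftMinor (Nat.le_succ m) U _ (Fin.strictMono_succAbove i)] at h1
    obtain ⟨r, hr, he⟩ := h1.eq
    refine ⟨r, hr, ?_⟩
    rw [← he]
    unfold DM
    congr 1
    ext a b
    simp only [Matrix.submatrix_apply, Matrix.of_apply, Fin.succAbove_last]
    rfl
  have hadj : U.conjTranspose * (D : ℂ) • (1 : Matrix (Fin (m + 1)) (Fin (m + 1)) ℂ) = U.adjugate := by
    rw [← hDe, ← Matrix.mul_adjugate, ← Matrix.mul_assoc, hU.1, Matrix.one_mul]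
  have hent : ∀ i : Fin (m + 1), ∃ r : ℝ, 0 < r ∧ star (U i (Fin.last m)) = (-1) ^ (i + m : ℕ) * (r : ℂ) := by
    intro i
    obtain ⟨r, hr, he⟩ := hmin i
    have h1 := congrFun (congrFun hadj (Fin.last m)) i
    rw [Matrix.adjugate_fin_succ_eq_det_submatrix, he] at h1
    simp only [Matrix.mul_smul, Matrix.mul_one, Matrix.smul_apply, Matrix.conjTranspose_apply,
      smul_eq_mul, Fin.val_last] at h1
    refine ⟨r / D, by positivity, ?_⟩
    have hD' : (D : ℂ) ≠ 0 := by exact_mod_cast hD.ne'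
    push_cast
    field_simp
    rw [← h1]; ring
  obtain ⟨a, ha, hae⟩ := hent i
  obtain ⟨b, hb, hbe⟩ := hent j
  have hae' : U i (Fin.last m) = (-1) ^ (i + m : ℕ) * (a : ℂ) := by
    rw [← star_star (U i (Fin.last m)), hae]; simp
  rw [hae', hbe]
  have : (fun x : Fin (m + 1) => (-1 : ℂ) ^ (x : ℕ)) i * (fun x : Fin (m + 1) => (-1 : ℂ) ^ (x : ℕ)) j *
      ((-1) ^ (i + m : ℕ) * (a : ℂ) * ((-1) ^ (j + m : ℕ) * (b : ℂ))) = ((a * b : ℝ) : ℂ) := by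
    simp only [pow_add]
    have e : ∀ k : ℕ, ((-1 : ℂ) ^ k) * ((-1 : ℂ) ^ k) = 1 := by
      intro k; rw [← mul_pow]; simp
    push_cast
    calc _ = ((-1 : ℂ) ^ (i : ℕ) * (-1 : ℂ) ^ (i : ℕ)) * ((-1 : ℂ) ^ (j : ℕ) * (-1 : ℂ) ^ (j : ℕ)) *
        ((-1 : ℂ) ^ m * (-1 : ℂ) ^ m) * (a * b) := by ring
      _ = _ := by rw [e, e, e]; ring
  rw [this]
  exact ⟨by rw [Complex.ofReal_re]; positivity, Complex.ofReal_im _⟩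

end SnPart


section EmbPart

/-- Matrices obtained from the identity by right multiplication by upper triangular matrices
and left multiplication by nonnegative elementary matrices between adjacent rows. -/
inductive Gen {n : ℕ} (r : Fin 3 → Fin n) : Matrix (Fin 3) (Fin 3) ℝ → Prop
  | one : Gen r 1
  | upper (x u : Matrix (Fin 3) (Fin 3) ℝ) (hu : ∀ i j, j < i → u i j = 0) (hd : ∀ i, u i i ≠ 0)
      (hx : Gen r x) : Gen r (x * u)
  | trans (x : Matrix (Fin 3) (Fin 3) ℝ) (s t : Fin 3) (c : ℝ) (hst : Adj (r s) (r t)) (hc : 0 ≤ c)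
      (hx : Gen r x) : Gen r (Matrix.transvection s t c * x)

theorem exists_ext {n m : ℕ} (hn : 3 + m = n) (r : Fin 3 → Fin n) (hr : Function.Injective r) :
    ∃ e : Fin 3 ⊕ Fin m ≃ Fin n, ∀ s, e (Sum.inl s) = r s := by
  obtain ⟨g, hg⟩ := Finset.exists_equiv_extend_of_card_eq (α := Fin 3 ⊕ Fin m) (β := Fin n)
    (t := Finset.univ) (by simp [hn]) (s := Finset.univ.image Sum.inl)
    (f := Sum.elim r (fun _ => r 0)) (by simp) (by
      intro a ha b hb h
      simp only [Finset.coe_image, Finset.coe_univ, Set.image_univ, Set.mem_range] at ha hb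
      obtain ⟨a, rfl⟩ := ha
      obtain ⟨b, rfl⟩ := hb
      simp only [Sum.elim_inl] at h
      rw [hr h])
  refine ⟨g.trans (Equiv.subtypeUnivEquiv (by simp)), fun s => ?_⟩
  have := hg (Sum.inl s) (by simp)
  simpa using this

/-- block embedding of a `3 × 3` matrix -/
def emb {n m : ℕ} (er ec : Fin 3 ⊕ Fin m ≃ Fin n) (x : Matrix (Fin 3) (Fin 3) ℝ) :
    Matrix (Fin n) (Fin n) ℝ :=
  (Matrix.fromBlocks x 0 0 1).submatrix er.symm ec.symm

theorem emb_mul {n m : ℕ} (er ec ed : Fin 3 ⊕ Fin m ≃ Fin n) (x u : Matrix (Fin 3) (Fin 3) ℝ) :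
    emb er ec (x * u) = emb er ed x * emb ed ec u := by
  unfold emb
  rw [Matrix.submatrix_mul_equiv, Matrix.fromBlocks_multiply]
  simp

theorem emb_one_self {n m : ℕ} (er : Fin 3 ⊕ Fin m ≃ Fin n) : emb er er 1 = 1 := by
  unfold emb
  rw [Matrix.fromBlocks_one, Matrix.submatrix_one_equiv]

theorem emb_transvection {n m : ℕ} (er : Fin 3 ⊕ Fin m ≃ Fin n) (s t : Fin 3) (c : ℝ) :
    emb er er (Matrix.transvection s t c) =
      Matrix.transvection (er (Sum.inl s)) (er (Sum.inl t)) c := by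
  ext i j
  obtain ⟨i, rfl⟩ := er.surjective i
  obtain ⟨j, rfl⟩ := er.surjective j
  rcases i with i | i <;> rcases j with j | j <;>
    simp [emb, Matrix.transvection, Matrix.single_apply, Matrix.one_apply]

theorem SN_emb {n m : ℕ} (er ec : Fin 3 ⊕ Fin m ≃ Fin n)
    (r k : Fin 3 → Fin n) (hr : ∀ s, er (Sum.inl s) = r s) (hk : ∀ s, ec (Sum.inl s) = k s)
    (hmono : StrictMono k) (q : Matrix (Fin 3) (Fin 3) ℝ) (hq : Gen r q) : SN (emb er ec q) := by
  induction hq with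
  | one =>
    refine SN_perm (ec.symm.trans er) _ fun i j => ?_
    unfold emb
    rw [Matrix.fromBlocks_one, Matrix.submatrix_apply, Matrix.one_apply]
    simp only [Equiv.symm_apply_eq, Equiv.trans_apply]
    congr
  | upper x u hu hd hx ih =>
    rw [emb_mul er ec ec]
    refine ih.mul_upper _ ?_ ?_
    · intro i j hij
      obtain ⟨i, rfl⟩ := ec.surjective i
      obtain ⟨j, rfl⟩ := ec.surjective j
      rcases i with i | i <;> rcases j with j | j
      · rw [hk, hk] at hij
        simpa [emb] using hu i j (hmono.lt_iff_lt.1 hij)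
      · simp [emb]
      · simp [emb]
      · have : i ≠ j := by rintro rfl; exact lt_irrefl _ hij
        simp [emb, this]
    · intro i
      obtain ⟨i, rfl⟩ := ec.surjective i
      rcases i with i | i
      · simpa [emb] using hd i
      · simp [emb]
  | trans x s t c hst hc hx ih =>
    rw [emb_mul er ec er, emb_transvection, hr, hr]
    exact ih.transvection _ _ hst c hc

theorem cond3 {n : ℕ} (hn : 3 ≤ n) (lam : Fin n → ℝ) (hanti : StrictAnti lam)
    (N B : Matrix (Fin n) (Fin n) ℂ) (hN : N.conjTranspose = -N) (hNB : N = Complex.I • B)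
    (Hb : ∀ L : ℝ → Matrix (Fin n) (Fin n) ℂ,
      (∀ t : ℝ, ∀ i j : Fin n, HasDerivAt (fun s => L s i j)
        ((L t * (L t * N - N * L t) - (L t * N - N * L t) * L t) i j) t) →
      L 0 ∈ SkewOrbitTNN lam → ∀ t : ℝ, 0 ≤ t → L t ∈ SkewOrbitTNN lam)
    (k : Fin 3 → Fin n) (hk : StrictMono k) (y0 : Fin 3) (σ : Fin n → ℂ)
    (hσ : ∀ U ∈ UnitaryTP n, ∀ i j, IsNonnegReal (σ i * σ j * (U i (k y0) * star (U j (k y0)))))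
    (r : Fin 3 → Fin n) (hr : Function.Injective r)
    (q : Matrix (Fin 3) (Fin 3) ℝ) (hq : q.transpose * q = 1) (hG : Gen r q)
    (s t : Fin 3) (hs : q s y0 = 0) :
    IsNonnegReal (σ (r s) * σ (r t) *
      (((∑ x, (∑ y, (q s y : ℂ) * lam (k y) * q x y) * (∑ z, B (r x) (r z) * q z y0))
      - lam (k y0) * ∑ z, B (r s) (r z) * q z y0) * q t y0)) := by
  obtain ⟨m, rfl⟩ := Nat.exists_eq_add_of_le hn
  obtain ⟨er, her⟩ := exists_ext rfl r hr
  obtain ⟨ec, hec⟩ := exists_ext rfl k hk.injective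
  have hval : ∀ s y, emb er ec q (r s) (k y) = q s y := by
    intro s y
    rw [← her, ← hec]; simp [emb]
  have hz1 : ∀ i, i ∉ Set.range r → ∀ y, emb er ec q i (k y) = 0 := by
    intro i hi y
    obtain ⟨i, rfl⟩ := er.surjective i
    rcases i with i | i
    · exact absurd ⟨i, (her i).symm⟩ hi
    · rw [← hec]; simp [emb]
  have hz2 : ∀ j, j ∉ Set.range k → ∀ s, emb er ec q (r s) j = 0 := by
    intro j hj s
    obtain ⟨j, rfl⟩ := ec.surjective j
    rcases j with j | j
    · exact absurd ⟨j, (hec j).symm⟩ hj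
    · rw [← her]; simp [emb]
  have horth : (emb er ec q).transpose * emb er ec q = 1 := by
    have : (emb er ec q).transpose = emb ec er q.transpose := by
      unfold emb
      rw [Matrix.transpose_submatrix, Matrix.fromBlocks_transpose]
      simp
    rw [this, ← emb_mul, hq, emb_one_self]
  have main := flow_cond lam hanti N B hN hNB Hb (k y0) σ hσ (emb er ec q) horth
    (SN_emb er ec r k her hec hk q hG) (r s) (r t) (by rw [hval]; exact hs)
  have hB : ∀ x, ∑ m, B x m * (emb er ec q m (k y0) : ℂ) = ∑ z, B x (r z) * q z y0 := by
    intro x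
    symm
    refine Fintype.sum_of_injective r hr _ _ (fun i hi => ?_) (fun z => ?_)
    · rw [hz1 i hi]; simp
    · rw [hval]
  have hA : ∀ x, ∑ j, (emb er ec q (r s) j : ℂ) * lam j * emb er ec q x j =
      ∑ y, (q s y : ℂ) * lam (k y) * emb er ec q x (k y) := by
    intro x
    symm
    refine Fintype.sum_of_injective k hk.injective _ _ (fun i hi => ?_) (fun z => ?_)
    · rw [hz2 i hi]; simp
    · rw [hval]
  simp only [hB, hA, hval] at main
  have hX : ∑ x, (∑ y, (q s y : ℂ) * lam (k y) * q x y) * (∑ z, B (r x) (r z) * q z y0) =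
      ∑ x, (∑ y, (q s y : ℂ) * lam (k y) * emb er ec q x (k y)) * (∑ z, B x (r z) * q z y0) := by
    refine Fintype.sum_of_injective r hr _ _ (fun i hi => ?_) (fun z => ?_)
    · simp [hz1 i hi]
    · simp only [hval]
  rw [hX]
  exact main

end EmbPart


section FinPart

theorem IsNonnegReal.of_mul {c : ℝ} {z : ℂ} (hc : 0 < c) (h : IsNonnegReal ((c : ℂ) * z)) :
    IsNonnegReal z := by
  have := IsNonnegReal.mul (a := ((c⁻¹ : ℝ) : ℂ))
    ⟨by rw [Complex.ofReal_re]; positivity, Complex.ofReal_im _⟩ h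
  rw [← mul_assoc, ← Complex.ofReal_mul, inv_mul_cancel₀ hc.ne'] at this
  simpa using this

theorem IsNonnegReal.antisymm {z : ℂ} (h : IsNonnegReal z) (h' : IsNonnegReal (-z)) : z = 0 := by
  refine Complex.ext (le_antisymm ?_ h.1) h.2
  have := h'.1
  simpa using this

theorem inj3 {n : ℕ} {a b c : Fin n} (hab : a ≠ b) (hac : a ≠ c) (hbc : b ≠ c) :
    Function.Injective ![a, b, c] := by
  intro x y h
  fin_cases x <;> fin_cases y <;> simp_all

theorem exists_third {n : ℕ} (hn : 3 ≤ n) (i j : Fin n) : ∃ l : Fin n, l ≠ i ∧ l ≠ j := by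
  by_contra hcon
  push Not at hcon
  have h0 := hcon ⟨0, by omega⟩
  have h1 := hcon ⟨1, by omega⟩
  have h2 := hcon ⟨2, by omega⟩
  simp only [ne_eq, Fin.ext_iff] at h0 h1 h2
  omega

def CondE1 {n : ℕ} (B : Matrix (Fin n) (Fin n) ℂ) (μ : Fin 3 → ℝ) : Prop :=
  ∀ r : Fin 3 → Fin n, Function.Injective r → ∀ q : Matrix (Fin 3) (Fin 3) ℝ,
    q.transpose * q = 1 → Gen r q → ∀ s t : Fin 3, q s 0 = 0 →
    IsNonnegReal (((∑ x, (∑ y, (q s y : ℂ) * μ y * q x y) * (∑ z, B (r x) (r z) * q z 0))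
      - μ 0 * ∑ z, B (r s) (r z) * q z 0) * q t 0)

def CondE2 {n : ℕ} (B : Matrix (Fin n) (Fin n) ℂ) (μ : Fin 3 → ℝ) : Prop :=
  ∀ r : Fin 3 → Fin n, Function.Injective r → ∀ q : Matrix (Fin 3) (Fin 3) ℝ,
    q.transpose * q = 1 → Gen r q → ∀ s t : Fin 3, q s 2 = 0 →
    IsNonnegReal ((-1 : ℂ) ^ (r s : ℕ) * (-1 : ℂ) ^ (r t : ℕ) *
      (((∑ x, (∑ y, (q s y : ℂ) * μ y * q x y) * (∑ z, B (r x) (r z) * q z 2))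
      - μ 2 * ∑ z, B (r s) (r z) * q z 2) * q t 2))

theorem sign_even {a b : ℕ} (h : Even (a + b)) : (-1 : ℂ) ^ a * (-1 : ℂ) ^ b = 1 := by
  rw [← pow_add]; exact h.neg_one_pow

theorem step_neg {n : ℕ} (hn : 3 ≤ n) (B : Matrix (Fin n) (Fin n) ℂ) (μ : Fin 3 → ℝ)
    (hμ : StrictAnti μ) (E1 : CondE1 B μ) (i j : Fin n) (hij : i ≠ j) : IsNonnegReal (-(B i j)) := by
  obtain ⟨l, hli, hlj⟩ := exists_third hn i j
  have h := E1 ![j, i, l] (inj3 hij.symm hlj.symm hli.symm) 1 (by simp) Gen.one 1 0 (by simp)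
  refine IsNonnegReal.of_mul (c := μ 0 - μ 1) (sub_pos.2 (hμ (by decide))) ?_
  convert h using 1
  simp [Fin.sum_univ_three, Matrix.one_apply]
  ring

theorem step_even {n : ℕ} (hn : 3 ≤ n) (B : Matrix (Fin n) (Fin n) ℂ) (μ ν : Fin 3 → ℝ)
    (hμ : StrictAnti μ) (E1 : CondE1 B μ) (hν : StrictAnti ν) (E2 : CondE2 B ν)
    (i j : Fin n) (hij : i ≠ j) (he : Even ((i : ℕ) + j)) : B i j = 0 := by
  refine IsNonnegReal.antisymm ?_ (step_neg hn B μ hμ E1 i j hij)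
  obtain ⟨l, hli, hlj⟩ := exists_third hn i j
  have h := E2 ![i, l, j] (inj3 hli.symm hij hlj) 1 (by simp) Gen.one 0 2 (by simp)
  refine IsNonnegReal.of_mul (c := ν 0 - ν 2) (sub_pos.2 (hν (by decide))) ?_
  convert h using 1
  simp [Fin.sum_univ_three, Matrix.one_apply, sign_even he]
  ring

theorem step_odd {n : ℕ} (hn : 3 ≤ n) (B : Matrix (Fin n) (Fin n) ℂ) (μ ν : Fin 3 → ℝ)
    (hμ : StrictAnti μ) (E1 : CondE1 B μ) (hν : StrictAnti ν) (E2 : CondE2 B ν)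
    (j a b : Fin n) (hab : Adj a b) (haj : a ≠ j) (hbj : b ≠ j) (he : ¬ Even ((a : ℕ) + j)) :
    B a j = 0 := by
  refine IsNonnegReal.antisymm ?_ (step_neg hn B μ hμ E1 a j haj)
  have hb : B b j = 0 := by
    refine step_even hn B μ ν hμ E1 hν E2 b j hbj ?_
    rw [Nat.even_iff] at he ⊢
    rcases hab with h | h <;> omega
  have hne : a ≠ b := by
    rintro rfl
    rcases hab with h | h <;> omega
  have hq : (!![1, 0, 0; 0, 3/5, -4/5; 0, 4/5, 3/5] : Matrix (Fin 3) (Fin 3) ℝ) =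
      Matrix.transvection 2 1 (4/3) * (1 * !![1, 0, 0; 0, 3/5, -4/5; 0, 0, 5/3]) := by
    ext x y
    fin_cases x <;> fin_cases y <;>
      simp [Matrix.transvection, Matrix.add_mul, Matrix.mul_apply, Fin.sum_univ_three,
        Matrix.single_apply] <;> norm_num
  have h := E1 ![j, a, b] (inj3 haj.symm hbj.symm hne)
    !![1, 0, 0; 0, 3/5, -4/5; 0, 4/5, 3/5] (by
      ext x y
      fin_cases x <;> fin_cases y <;>
        simp [Matrix.mul_apply, Fin.sum_univ_three] <;> norm_num) (by
      rw [hq]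
      refine Gen.trans _ _ _ _ hab.symm (by norm_num) (Gen.upper _ _ ?_ ?_ Gen.one)
      · intro x y hxy
        fin_cases x <;> fin_cases y <;> simp at hxy ⊢
      · intro x
        fin_cases x <;> simp) 2 0 (by simp)
  refine IsNonnegReal.of_mul (c := (12/25) * (μ 1 - μ 2))
    (mul_pos (by norm_num) (sub_pos.2 (hμ (by decide)))) ?_
  convert h using 1
  simp [Fin.sum_univ_three, hb]
  left
  ring

theorem step_offdiag {n : ℕ} (hn : 3 ≤ n) (B : Matrix (Fin n) (Fin n) ℂ)
    (hB : B.conjTranspose = B) (μ ν : Fin 3 → ℝ)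
    (hμ : StrictAnti μ) (E1 : CondE1 B μ) (hν : StrictAnti ν) (E2 : CondE2 B ν)
    (i j : Fin n) (hij : i ≠ j) : B i j = 0 := by
  by_cases he : Even ((i : ℕ) + j)
  · exact step_even hn B μ ν hμ E1 hν E2 i j hij he
  have hc : (∃ b, Adj i b ∧ b ≠ j) ∨ (∃ b, Adj j b ∧ b ≠ i) := by
    have hi := i.2
    have hj := j.2
    have hij' : (i : ℕ) ≠ j := fun h => hij (Fin.ext h)
    by_cases h1 : (i : ℕ) + 1 < n ∧ (i : ℕ) + 1 ≠ j
    · exact Or.inl ⟨⟨i + 1, h1.1⟩, Or.inl rfl, fun h => h1.2 (Fin.ext_iff.1 h)⟩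
    · by_cases h2 : 1 ≤ (i : ℕ) ∧ (i : ℕ) - 1 ≠ j
      · exact Or.inl ⟨⟨i - 1, by omega⟩, Or.inr (by simp only; omega),
          fun h => h2.2 (Fin.ext_iff.1 h)⟩
      · by_cases h3 : (j : ℕ) + 1 < n ∧ (j : ℕ) + 1 ≠ i
        · exact Or.inr ⟨⟨j + 1, h3.1⟩, Or.inl rfl, fun h => h3.2 (Fin.ext_iff.1 h)⟩
        · refine Or.inr ⟨⟨j - 1, by omega⟩, Or.inr (by simp only; omega), fun h => ?_⟩
          have := Fin.ext_iff.1 h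
          simp only at this
          omega
  rcases hc with ⟨b, hab, hb⟩ | ⟨b, hab, hb⟩
  · exact step_odd hn B μ ν hμ E1 hν E2 j i b hab hij hb he
  · have h := step_odd hn B μ ν hμ E1 hν E2 i j b hab hij.symm hb (by rwa [add_comm])
    rw [← hB, Matrix.conjTranspose_apply, h, star_zero]

theorem step_mid_ge {n : ℕ} (B : Matrix (Fin n) (Fin n) ℂ) (μ : Fin 3 → ℝ)
    (hμ : StrictAnti μ) (E1 : CondE1 B μ) (hoff : ∀ i j, i ≠ j → B i j = 0)
    (a b c : Fin n) (hab : Adj a b) (hac : Adj a c) (hbc : b ≠ c) :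
    IsNonnegReal (B a a - B c c) := by
  have hne1 : a ≠ b := by
    rintro rfl
    rcases hab with h | h <;> omega
  have hne2 : a ≠ c := by
    rintro rfl
    rcases hac with h | h <;> omega
  have hq : (!![3/5, -16/25, -12/25; 0, -3/5, 4/5; 4/5, 12/25, 9/25] : Matrix (Fin 3) (Fin 3) ℝ) =
      Matrix.transvection 0 1 (5/3) * (Matrix.transvection 2 0 (4/3) *
        (1 * !![3/5, 9/25, -136/75; 0, -3/5, 4/5; 0, 0, 25/9])) := by
    ext x y
    fin_cases x <;> fin_cases y <;>
      simp [Matrix.transvection, Matrix.add_mul, Matrix.mul_apply, Fin.sum_univ_three,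
        Matrix.single_apply] <;> norm_num
  have h := E1 ![a, b, c] (inj3 hne1 hne2 hbc)
    !![3/5, -16/25, -12/25; 0, -3/5, 4/5; 4/5, 12/25, 9/25] (by
      ext x y
      fin_cases x <;> fin_cases y <;>
        simp [Matrix.mul_apply, Fin.sum_univ_three] <;> norm_num) (by
      rw [hq]
      refine Gen.trans _ _ _ _ hab (by norm_num) (Gen.trans _ _ _ _ hac.symm (by norm_num)
        (Gen.upper _ _ ?_ ?_ Gen.one))
      · intro x y hxy
        fin_cases x <;> fin_cases y <;> simp at hxy ⊢
      · intro x
        fin_cases x <;> simp) 1 0 (by simp)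
  refine IsNonnegReal.of_mul (c := (432/3125) * (μ 1 - μ 2))
    (mul_pos (by norm_num) (sub_pos.2 (hμ (by decide)))) ?_
  convert h using 1
  simp [Fin.sum_univ_three, hoff a b hne1, hoff a c hne2, hoff b c hbc, hoff b a hne1.symm,
    hoff c a hne2.symm, hoff c b hbc.symm]
  ring

theorem step_end_ge {n : ℕ} (B : Matrix (Fin n) (Fin n) ℂ) (ν : Fin 3 → ℝ)
    (hν : StrictAnti ν) (E2 : CondE2 B ν) (hoff : ∀ i j, i ≠ j → B i j = 0)
    (a b c : Fin n) (hca : Adj c a) (hcb : Adj c b) (hab : a ≠ b) :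
    IsNonnegReal (B a a - B c c) := by
  have hne1 : a ≠ c := by
    rintro rfl
    rcases hca with h | h <;> omega
  have hne2 : b ≠ c := by
    rintro rfl
    rcases hcb with h | h <;> omega
  have hev : Even ((b : ℕ) + a) := by
    rw [Nat.even_iff]
    rcases hca with h | h <;> rcases hcb with h' | h' <;> omega
  have hq : (!![16/25, 12/25, 3/5; 3/5, -4/5, 0; 12/25, 9/25, -4/5] : Matrix (Fin 3) (Fin 3) ℝ) =
      Matrix.transvection 1 2 (5/4) * (Matrix.transvection 2 0 (3/4) *
        (1 * !![16/25, 12/25, 3/5; 0, -5/4, 1; 0, 0, -5/4])) := by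
    ext x y
    fin_cases x <;> fin_cases y <;>
      simp [Matrix.transvection, Matrix.add_mul, Matrix.mul_apply, Fin.sum_univ_three,
        Matrix.single_apply] <;> norm_num
  have h := E2 ![a, b, c] (inj3 hab hne1 hne2)
    !![16/25, 12/25, 3/5; 3/5, -4/5, 0; 12/25, 9/25, -4/5] (by
      ext x y
      fin_cases x <;> fin_cases y <;>
        simp [Matrix.mul_apply, Fin.sum_univ_three] <;> norm_num) (by
      rw [hq]
      refine Gen.trans _ _ _ _ hcb.symm (by norm_num) (Gen.trans _ _ _ _ hca (by norm_num)
        (Gen.upper _ _ ?_ ?_ Gen.one))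
      · intro x y hxy
        fin_cases x <;> fin_cases y <;> simp at hxy ⊢
      · intro x
        fin_cases x <;> simp) 1 0 (by simp)
  refine IsNonnegReal.of_mul (c := (432/3125) * (ν 0 - ν 1))
    (mul_pos (by norm_num) (sub_pos.2 (hν (by decide)))) ?_
  convert h using 1
  simp [Fin.sum_univ_three, hoff a b hab, hoff a c hne1, hoff b c hne2, hoff b a hab.symm,
    hoff c a hne1.symm, hoff c b hne2.symm, sign_even hev]
  ring

theorem step_scalar {n : ℕ} (hn : 3 ≤ n) (B : Matrix (Fin n) (Fin n) ℂ)
    (hB : B.conjTranspose = B) (μ ν : Fin 3 → ℝ)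
    (hμ : StrictAnti μ) (E1 : CondE1 B μ) (hν : StrictAnti ν) (E2 : CondE2 B ν) :
    ∃ c : ℂ, B = c • (1 : Matrix (Fin n) (Fin n) ℂ) := by
  have hoff := step_offdiag hn B hB μ ν hμ E1 hν E2
  have hmid : ∀ a b c : Fin n, Adj a b → Adj a c → b ≠ c → B a a = B c c := by
    intro a b c hab hac hbc
    have h1 := step_mid_ge B μ hμ E1 hoff a b c hab hac hbc
    have h2 := step_end_ge B ν hν E2 hoff c b a hac hab hbc.symm
    rw [← neg_sub] at h2
    exact sub_eq_zero.1 (h1.antisymm h2)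
  have hsucc : ∀ m : ℕ, ∀ hm : m + 1 < n, B ⟨m, by omega⟩ ⟨m, by omega⟩ = B ⟨m + 1, hm⟩ ⟨m + 1, hm⟩ := by
    intro m hm
    by_cases h : m + 2 < n
    · refine (hmid ⟨m + 1, hm⟩ ⟨m + 2, h⟩ ⟨m, by omega⟩ (Or.inl rfl) (Or.inr rfl) ?_).symm
      simp
    · refine hmid ⟨m, by omega⟩ ⟨m - 1, by omega⟩ ⟨m + 1, hm⟩ (Or.inr ?_) (Or.inl rfl) ?_
      · simp only; omega
      · simp only [ne_eq, Fin.mk.injEq]; omega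
  have hall : ∀ m : ℕ, ∀ hm : m < n, B ⟨m, hm⟩ ⟨m, hm⟩ = B ⟨0, by omega⟩ ⟨0, by omega⟩ := by
    intro m
    induction m with
    | zero => intro _; rfl
    | succ m ih => intro hm; rw [← hsucc m hm, ih]
  refine ⟨B ⟨0, by omega⟩ ⟨0, by omega⟩, ?_⟩
  ext i j
  rw [Matrix.smul_apply, Matrix.one_apply, smul_eq_mul]
  split_ifs with h
  · subst h; rw [mul_one]; exact hall i i.2
  · rw [mul_zero]; exact hoff i j h

end FinPart

/-- Let `n ≥ 3`, let `λ` be strictly decreasing and let `N` be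
skew-Hermitian. Then `N` is a scalar multiple of the identity if and only if every
solution `L` of the double-bracket flow `L′(t) = [L(t), [L(t), N]]` (derivatives taken
entrywise) with `L(0) ∈ O_λ^{≥0}` satisfies `L(t) ∈ O_λ^{≥0}` for all `t ≥ 0`. -/
theorem double_bracket_flow_preserves_positivity_iff_scalar {n : ℕ} (hn : 3 ≤ n)
    (lam : Fin n → ℝ) (hanti : StrictAnti lam)
    (N : Matrix (Fin n) (Fin n) ℂ) (hN : N.conjTranspose = -N) :
    (∃ c : ℂ, N = c • (1 : Matrix (Fin n) (Fin n) ℂ)) ↔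
    (∀ L : ℝ → Matrix (Fin n) (Fin n) ℂ,
      (∀ t : ℝ, ∀ i j : Fin n, HasDerivAt (fun s => L s i j)
        ((L t * (L t * N - N * L t) - (L t * N - N * L t) * L t) i j) t) →
      L 0 ∈ SkewOrbitTNN lam → ∀ t : ℝ, 0 ≤ t → L t ∈ SkewOrbitTNN lam) := by
  constructor
  · rintro ⟨c, rfl⟩ L hL h0 t _
    have hz : ∀ t, EHD L 0 t := by
      intro t i j
      have := hL t i j
      simpa using this
    have hc : L t = L 0 := by
      ext i j
      exact is_const_of_deriv_eq_zero (f := fun s => L s i j)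
        (fun x => (hz x i j).differentiableAt) (fun x => (hz x i j).deriv) t 0
    rw [hc]; exact h0
  · intro Hb
    set B := (-Complex.I) • N with hBdef
    have hNB : N = Complex.I • B := by
      rw [hBdef, smul_smul]; simp
    have hB : B.conjTranspose = B := by
      rw [hBdef, Matrix.conjTranspose_smul, hN]; simp
    let k1 : Fin 3 → Fin n := fun y => ⟨y, by have := y.2; omega⟩
    let k2 : Fin 3 → Fin n := fun y => ⟨n - 3 + y, by have := y.2; omega⟩
    have hk1 : StrictMono k1 := by
      intro x y hxy
      exact hxy
    have hk2 : StrictMono k2 := by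
      intro x y hxy
      have h' : (x : ℕ) < y := hxy
      change n - 3 + (x : ℕ) < n - 3 + (y : ℕ)
      omega
    have E1 : CondE1 B (fun y => lam (k1 y)) := by
      intro r hr q hq hG s t hs
      have := cond3 hn lam hanti N B hN hNB Hb k1 hk1 0 (fun _ => 1)
        (fun U hU i j => sign_first (k1 0) rfl U hU i j) r hr q hq hG s t hs
      simpa only [one_mul] using this
    have E2 : CondE2 B (fun y => lam (k2 y)) := by
      intro r hr q hq hG s t hs
      exact cond3 hn lam hanti N B hN hNB Hb k2 hk2 2 (fun x => (-1 : ℂ) ^ (x : ℕ))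
        (fun U hU i j => sign_last (k2 2) (by
          change n - 3 + 2 + 1 = n
          omega) U hU i j) r hr q hq hG s t hs
    obtain ⟨c, hc⟩ := step_scalar hn B hB _ _ (fun x y h => hanti (hk1 h)) E1
      (fun x y h => hanti (hk2 h)) E2
    exact ⟨Complex.I * c, by rw [hNB, hc, smul_smul]⟩
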